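/- arXiv:1408.4153 — 3 statements merged into one kernel-verified Lean document; each statement's English description precedes it below -/
import Mathlib

section
/- Let P(z) = Σ_{m=0}^N p_m z^m have nonnegative real coefficients, exact degree N, p_0 > 0, and all roots in the closed left half plane. If Var(X) > 0, then sup_{x ∈ ℝ} |F(x) − G(x)| ≤ 12/√Var(X), where F(x) = (1/P(1)) Σ_{m ≤ E[X] + x·√Var(X)} p_m and G is the standard normal CDF G(x) = (2π)^{−1/2} ∫_{−∞}^x e^{−u²/2} du. -/
open Finset

/-- `P(1) = Σ pₘ`, the normalizing constant. -/
noncomputable def Psum (P : Polynomial ℝ) : ℝ := P.eval 1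

/-- `E[X] = Σ m pₘ / P(1)`. -/
noncomputable def EX (P : Polynomial ℝ) : ℝ :=
  (∑ m ∈ Finset.range (P.natDegree + 1), (m : ℝ) * P.coeff m) / Psum P

/-- `Var(X) = Σ m² pₘ / P(1) − E[X]²`. -/
noncomputable def VarX (P : Polynomial ℝ) : ℝ :=
  (∑ m ∈ Finset.range (P.natDegree + 1), (m : ℝ) ^ 2 * P.coeff m) / Psum P - (EX P) ^ 2

/-- `F(x)`, the CDF of the normalized variable `(X − E[X])/√Var(X)`. -/
noncomputable def Fcdf (P : Polynomial ℝ) (x : ℝ) : ℝ :=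
  (∑ m ∈ Finset.range (P.natDegree + 1),
      if (m : ℝ) ≤ EX P + x * Real.sqrt (VarX P) then P.coeff m else 0) / Psum P

/-- `G(x)`, the standard normal CDF. -/
noncomputable def Gcdf (x : ℝ) : ℝ :=
  (Real.sqrt (2 * Real.pi))⁻¹ * ∫ u in Set.Iic x, Real.exp (-u ^ 2 / 2)


/-- linear functional `Q ↦ Σ qₘ g(m)` -/
noncomputable def LL (g : ℕ → ℝ) : Polynomial ℝ →ₗ[ℝ] ℝ :=
  Polynomial.lsum (fun n => (g n) • (LinearMap.id : ℝ →ₗ[ℝ] ℝ))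

lemma LL_eq_sum (g : ℕ → ℝ) (Q : Polynomial ℝ) :
    LL g Q = ∑ m ∈ Finset.range (Q.natDegree + 1), Q.coeff m * g m := by
  rw [LL, Polynomial.lsum_apply, Polynomial.sum_over_range]
  · simp [mul_comm]
  · simp

lemma LL_monomial (g : ℕ → ℝ) (n : ℕ) (a : ℝ) : LL g (Polynomial.monomial n a) = a * g n := by
  rw [LL, Polynomial.lsum_apply, Polynomial.sum_monomial_index] <;> simp [mul_comm]

lemma LL_mono {g h : ℕ → ℝ} (hg : ∀ n, g n ≤ h n) {Q : Polynomial ℝ} (hQ : ∀ m, 0 ≤ Q.coeff m) :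
    LL g Q ≤ LL h Q := by
  rw [LL_eq_sum, LL_eq_sum]
  exact Finset.sum_le_sum fun m _ => mul_le_mul_of_nonneg_left (hg m) (hQ m)

lemma LL_one (Q : Polynomial ℝ) : LL (fun _ => 1) Q = Q.eval 1 := by
  rw [LL_eq_sum, Polynomial.eval_eq_sum_range]; simp

lemma LL_fadd (g h : ℕ → ℝ) (Q : Polynomial ℝ) : LL (fun n => g n + h n) Q = LL g Q + LL h Q := by
  simp only [LL_eq_sum, mul_add, Finset.sum_add_distrib]

lemma LL_fsub (g h : ℕ → ℝ) (Q : Polynomial ℝ) : LL (fun n => g n - h n) Q = LL g Q - LL h Q := by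
  simp only [LL_eq_sum, mul_sub, Finset.sum_sub_distrib]

lemma LL_fmul (c : ℝ) (h : ℕ → ℝ) (Q : Polynomial ℝ) : LL (fun n => c * h n) Q = c * LL h Q := by
  simp only [LL_eq_sum, Finset.mul_sum]
  exact Finset.sum_congr rfl fun m _ => by ring

lemma LL_const (c : ℝ) (Q : Polynomial ℝ) : LL (fun _ => c) Q = c * Q.eval 1 := by
  have := LL_fmul c (fun _ => 1) Q
  simpa [LL_one] using this

lemma LL_mul (g : ℕ → ℝ) (P Q : Polynomial ℝ) :
    LL g (P * Q) = LL (fun s => LL (fun n => g (s + n)) Q) P := by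
  induction P using Polynomial.induction_on' with
  | add p q hp hq => rw [add_mul, map_add, map_add, hp, hq]
  | monomial n a =>
    rw [LL_monomial]
    induction Q using Polynomial.induction_on' with
    | add p q hp hq => rw [mul_add, map_add, map_add, hp, hq, mul_add]
    | monomial m b =>
      rw [Polynomial.monomial_mul_monomial, LL_monomial, LL_monomial]; ring

lemma LL_X_sub_one_mul (g : ℕ → ℝ) (R : Polynomial ℝ) :
    LL g ((Polynomial.X - 1) * R) = LL (fun n => g (n + 1) - g n) R := by
  induction R using Polynomial.induction_on' with
  | add p q hp hq => rw [mul_add, map_add, map_add, hp, hq]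
  | monomial n a =>
    rw [sub_mul, one_mul, Polynomial.X_mul_monomial, map_sub, LL_monomial, LL_monomial, LL_monomial]
    ring

lemma LL_X_deriv (g : ℕ → ℝ) (P : Polynomial ℝ) :
    LL g (Polynomial.X * Polynomial.derivative P) = LL (fun n => (n : ℝ) * g n) P := by
  induction P using Polynomial.induction_on' with
  | add p q hp hq => rw [map_add, mul_add, map_add, map_add, hp, hq]
  | monomial n a =>
    rw [Polynomial.derivative_monomial, Polynomial.X_mul_monomial, LL_monomial, LL_monomial]
    rcases n with _ | n
    · simp
    · simp; ring

/-- Polynomials with nonnegative coefficients summing to `1` that have a zero-bias coupling at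
distance at most two. -/
def Good (P : Polynomial ℝ) : Prop :=
  P.eval 1 = 1 ∧ (∀ m, 0 ≤ P.coeff m) ∧ ∃ R : Polynomial ℝ,
    (Polynomial.X - 1) * R = Polynomial.X * Polynomial.derivative P
        - Polynomial.C ((Polynomial.derivative P).eval 1) * P ∧
    (∀ m, 0 ≤ R.coeff m) ∧
    ∀ h H : ℕ → ℝ, (∀ n m, m ≤ n + 1 → n ≤ m + 2 → h n ≤ H m) → R.eval 1 * LL h P ≤ LL H R

lemma coeff_mul_nonneg {P Q : Polynomial ℝ} (hP : ∀ m, 0 ≤ P.coeff m) (hQ : ∀ m, 0 ≤ Q.coeff m) :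
    ∀ m, 0 ≤ (P * Q).coeff m := by
  intro m
  rw [Polynomial.coeff_mul]
  exact Finset.sum_nonneg fun x _ => mul_nonneg (hP _) (hQ _)

lemma Good.mul {P Q : Polynomial ℝ} (hP : Good P) (hQ : Good Q) : Good (P * Q) := by
  obtain ⟨p1, pc, R, hR, Rc, hRH⟩ := hP
  obtain ⟨q1, qc, S, hS, Sc, hSH⟩ := hQ
  refine ⟨by simp [p1, q1], coeff_mul_nonneg pc qc, R * Q + P * S, ?_, ?_, ?_⟩
  · have e : (Polynomial.derivative (P * Q)).eval 1
        = (Polynomial.derivative P).eval 1 + (Polynomial.derivative Q).eval 1 := by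
      simp [p1, q1]
    rw [e, Polynomial.derivative_mul, map_add]
    linear_combination Q * hR + P * hS
  · intro m
    rw [Polynomial.coeff_add]
    exact add_nonneg (coeff_mul_nonneg Rc qc m) (coeff_mul_nonneg pc Sc m)
  · intro h H hh
    have e : (R * Q + P * S).eval 1 = R.eval 1 + S.eval 1 := by simp [p1, q1]
    rw [e, map_add, add_mul]
    refine add_le_add ?_ ?_
    · rw [mul_comm P Q, mul_comm R Q, LL_mul, LL_mul, ← LL_fmul]
      refine LL_mono (fun s => hRH _ _ fun n m h1 h2 => hh _ _ (by omega) (by omega)) qc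
    · rw [LL_mul, LL_mul, ← LL_fmul]
      refine LL_mono (fun s => hSH _ _ fun n m h1 h2 => hh _ _ (by omega) (by omega)) pc

lemma Good.quad {q0 q1 q2 : ℝ} (h0 : 0 ≤ q0) (h1 : 0 ≤ q1) (h2 : 0 ≤ q2) (hs : q0 + q1 + q2 = 1) :
    Good (Polynomial.C q2 * Polynomial.X ^ 2 + Polynomial.C q1 * Polynomial.X
      + Polynomial.C q0) := by
  have hmon : Polynomial.C q2 * Polynomial.X ^ 2 + Polynomial.C q1 * Polynomial.X
      + Polynomial.C q0 = Polynomial.monomial 2 q2 + Polynomial.monomial 1 q1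
      + Polynomial.monomial 0 q0 := by
    simp [← Polynomial.C_mul_X_pow_eq_monomial]
  have hL : ∀ h : ℕ → ℝ, LL h (Polynomial.C q2 * Polynomial.X ^ 2 + Polynomial.C q1 * Polynomial.X
      + Polynomial.C q0) = q2 * h 2 + q1 * h 1 + q0 * h 0 := by
    intro h
    rw [hmon, map_add, map_add, LL_monomial, LL_monomial, LL_monomial]
  refine ⟨by simp; linarith, ?_, Polynomial.C ((2 * q0 + q1) * q2) * Polynomial.X +
    Polynomial.C ((q1 + 2 * q2) * q0), ?_, ?_, ?_⟩
  · intro m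
    simp only [hmon, Polynomial.coeff_add, Polynomial.coeff_monomial]
    have i2 : (0:ℝ) ≤ if 2 = m then q2 else 0 := by split_ifs <;> simp [h2]
    have i1 : (0:ℝ) ≤ if 1 = m then q1 else 0 := by split_ifs <;> simp [h1]
    have i0 : (0:ℝ) ≤ if 0 = m then q0 else 0 := by split_ifs <;> simp [h0]
    linarith
  · have hC : Polynomial.C q0 + Polynomial.C q1 + Polynomial.C q2 = 1 := by
      rw [← map_add, ← map_add, hs, map_one]
    simp only [Polynomial.derivative_add, Polynomial.derivative_C_mul, Polynomial.derivative_X_pow,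
      Polynomial.derivative_X, Polynomial.derivative_C, Polynomial.eval_add, Polynomial.eval_mul,
      Polynomial.eval_C, Polynomial.eval_pow, Polynomial.eval_X, Polynomial.eval_one,
      Polynomial.eval_zero, map_add, map_mul, map_ofNat]
    have h2C : (Polynomial.C (2 : ℝ)) = 2 := rfl
    simp [h2C]
    generalize (Polynomial.C q0) = a at *
    generalize (Polynomial.C q1) = b at *
    generalize (Polynomial.C q2) = c at *
    have ha : a = 1 - b - c := by linear_combination hC
    subst ha
    ring
  · intro m
    simp only [Polynomial.coeff_add, Polynomial.coeff_C_mul, Polynomial.coeff_X, Polynomial.coeff_C]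
    have : 0 ≤ (2 * q0 + q1) * q2 := by positivity
    have : 0 ≤ (q1 + 2 * q2) * q0 := by positivity
    split_ifs <;> nlinarith
  · intro h H hh
    have e : LL H (Polynomial.C ((2 * q0 + q1) * q2) * Polynomial.X +
      Polynomial.C ((q1 + 2 * q2) * q0)) = ((2 * q0 + q1) * q2) * H 1 + ((q1 + 2 * q2) * q0) * H 0 := by
      rw [Polynomial.C_mul_X_eq_monomial, ← Polynomial.monomial_zero_left, map_add, LL_monomial,
        LL_monomial]
    rw [e, hL]
    have key : ∀ m, m ≤ 1 → q2 * h 2 + q1 * h 1 + q0 * h 0 ≤ H m := by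
      intro m hm
      have a0 := mul_le_mul_of_nonneg_left (hh 0 m (by omega) (by omega)) h0
      have a1 := mul_le_mul_of_nonneg_left (hh 1 m (by omega) (by omega)) h1
      have a2 := mul_le_mul_of_nonneg_left (hh 2 m (by omega) (by omega)) h2
      have : H m = (q0 + q1 + q2) * H m := by rw [hs, one_mul]
      rw [this]; linarith
    simp only [Polynomial.eval_add, Polynomial.eval_mul, Polynomial.eval_C, Polynomial.eval_X,
      mul_one, add_mul]
    have p1 : 0 ≤ (2 * q0 + q1) * q2 := by positivity
    have p2 : 0 ≤ (q1 + 2 * q2) * q0 := by positivity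
    have k1 := mul_le_mul_of_nonneg_left (key 1 le_rfl) p1
    have k2 := mul_le_mul_of_nonneg_left (key 0 (by omega)) p2
    linarith

/-- A real quadratic without complex roots in the open right half plane has coefficients of the
same sign. -/
lemma quad_sign {a b c : ℝ} (hs : a + b + c = 1)
    (hr : ∀ ζ : ℂ, (a : ℂ) * ζ ^ 2 + b * ζ + c = 0 → ζ.re ≤ 0) : 0 ≤ a ∧ 0 ≤ b ∧ 0 ≤ c := by
  by_cases ha : a = 0
  · subst ha
    by_cases hb : b = 0
    · subst hb
      refine ⟨le_rfl, le_rfl, by linarith⟩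
    · have := hr ((-c / b : ℝ) : ℂ) (by
        have : (b : ℂ) ≠ 0 := by exact_mod_cast hb
        push_cast; field_simp; ring)
      rw [Complex.ofReal_re] at this
      have h2 : 0 ≤ c / b := by rw [neg_div] at this; linarith
      have h3 : c = (c / b) * b := by field_simp
      have h4 : (1 + c / b) * b = 1 := by linarith
      have h5 : 0 < b := by
        by_contra hcon
        nlinarith
      refine ⟨le_rfl, h5.le, ?_⟩
      rw [h3]; positivity
  · have haC : (a : ℂ) ≠ 0 := by exact_mod_cast ha
    have hba : 0 ≤ b / a ∧ 0 ≤ c / a := by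
      rcases le_or_gt 0 (b ^ 2 - 4 * a * c) with hD | hD
      · set s := Real.sqrt (b ^ 2 - 4 * a * c) with hsd
        have hss : s ^ 2 = b ^ 2 - 4 * a * c := Real.sq_sqrt hD
        have hssC : (s : ℂ) ^ 2 = b ^ 2 - 4 * a * c := by exact_mod_cast hss
        have r1 := hr (((-b + s) / (2 * a) : ℝ) : ℂ) (by
          push_cast; field_simp; linear_combination hssC)
        have r2 := hr (((-b - s) / (2 * a) : ℝ) : ℂ) (by
          push_cast; field_simp; linear_combination hssC)
        rw [Complex.ofReal_re] at r1 r2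
        have e1 : (-b + s) / (2 * a) + (-b - s) / (2 * a) = - (b / a) := by field_simp; ring
        have e2 : (-b + s) / (2 * a) * ((-b - s) / (2 * a)) = c / a := by
          field_simp; linear_combination -hss
        exact ⟨by linarith, by rw [← e2]; exact mul_nonneg_of_nonpos_of_nonpos r1 r2⟩
      · set s := Real.sqrt (-(b ^ 2 - 4 * a * c)) with hsd
        have hss : s ^ 2 = -(b ^ 2 - 4 * a * c) := Real.sq_sqrt (by linarith)
        have hssC : (s : ℂ) ^ 2 = -(b ^ 2 - 4 * a * c) := by exact_mod_cast hss
        have r1 := hr (((-b / (2 * a) : ℝ) : ℂ) + ((s / (2 * a) : ℝ) : ℂ) * Complex.I) (by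
          push_cast; field_simp
          linear_combination ((s : ℂ) ^ 2) * Complex.I_sq - hssC)
        rw [Complex.add_re, Complex.ofReal_re, Complex.re_ofReal_mul, Complex.I_re, mul_zero, add_zero] at r1
        constructor
        · have : -b / (2 * a) = - (b / a) / 2 := by field_simp
          linarith
        · have : 0 < a * c := by nlinarith [sq_nonneg b]
          have e : c / a = (a * c) / a ^ 2 := by field_simp
          rw [e]; positivity
    obtain ⟨hb, hc⟩ := hba
    have eb : b = (b / a) * a := by field_simp
    have ec : c = (c / a) * a := by field_simp
    have h4 : (1 + b / a + c / a) * a = 1 := by linarith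
    have h5 : 0 < a := by
      by_contra hcon
      nlinarith
    refine ⟨h5.le, ?_, ?_⟩
    · rw [eb]; positivity
    · rw [ec]; positivity

lemma eval_one_ne {P : Polynomial ℝ} (hr : ∀ ζ : ℂ, Polynomial.aeval ζ P = 0 → ζ.re ≤ 0) :
    P.eval 1 ≠ 0 := by
  intro h
  have := hr ((1 : ℝ) : ℂ) (by
    have : Polynomial.aeval (algebraMap ℝ ℂ 1) P = algebraMap ℝ ℂ (Polynomial.aeval 1 P) :=
      Polynomial.aeval_algebraMap_apply _ _ _
    rw [Polynomial.coe_aeval_eq_eval, h] at this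
    simpa using this)
  simp at this
  linarith

lemma good_of_roots (P : Polynomial ℝ)
    (hr : ∀ ζ : ℂ, Polynomial.aeval ζ P = 0 → ζ.re ≤ 0) :
    Good (Polynomial.C (P.eval 1)⁻¹ * P) := by
  induction P using WfDvdMonoid.induction_on_irreducible with
  | zero => 
    have := hr 1 (by simp)
    simp at this
    linarith
  | unit u hu =>
    obtain ⟨a, ha, rfl⟩ := Polynomial.isUnit_iff.mp hu
    have ha' : a ≠ 0 := ha.ne_zero
    have := Good.quad (q0 := 1) (q1 := 0) (q2 := 0) (by norm_num) le_rfl le_rfl (by norm_num)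
    rw [Polynomial.eval_C, ← map_mul, inv_mul_cancel₀ ha']
    simpa using this
  | mul a i ha hi ih =>
    have hra : ∀ ζ : ℂ, Polynomial.aeval ζ a = 0 → ζ.re ≤ 0 := fun ζ h => hr ζ (by simp [h])
    have hri : ∀ ζ : ℂ, Polynomial.aeval ζ i = 0 → ζ.re ≤ 0 := fun ζ h => hr ζ (by simp [h])
    have e : Polynomial.C ((i * a).eval 1)⁻¹ * (i * a)
        = (Polynomial.C (i.eval 1)⁻¹ * i) * (Polynomial.C (a.eval 1)⁻¹ * a) := by
      rw [Polynomial.eval_mul, mul_inv, map_mul]; ring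
    rw [e]
    refine Good.mul ?_ (ih hra)
    have hi1 := eval_one_ne hri
    have hd := hi.degree_le_two
    have hq := Polynomial.eq_quadratic_of_degree_le_two hd
    set k := (i.eval 1)⁻¹ with hk
    have hk0 : k ≠ 0 := inv_ne_zero hi1
    have hie : i.eval 1 = i.coeff 2 + i.coeff 1 + i.coeff 0 := by
      conv_lhs => rw [hq]
      simp
    have hform : Polynomial.C k * i = Polynomial.C (k * i.coeff 2) * Polynomial.X ^ 2 +
        Polynomial.C (k * i.coeff 1) * Polynomial.X + Polynomial.C (k * i.coeff 0) := by
      conv_lhs => rw [hq]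
      simp only [map_mul]; ring
    have hsum : k * i.coeff 2 + k * i.coeff 1 + k * i.coeff 0 = 1 := by
      rw [← mul_add, ← mul_add, ← hie, hk, inv_mul_cancel₀ hi1]
    obtain ⟨h2, h1, h0⟩ := quad_sign hsum (by
      intro ζ hζ
      apply hri
      rw [hq]
      simp only [map_add, map_mul, map_pow, Polynomial.aeval_X, Polynomial.aeval_C]
      have hkC : (k : ℂ) ≠ 0 := by exact_mod_cast hk0
      apply mul_left_cancel₀ hkC
      push_cast at hζ
      simp only [Complex.coe_algebraMap]
      linear_combination hζ)
    rw [hform]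
    exact Good.quad h0 h1 h2 (by linarith)
lemma gauss_integrable : MeasureTheory.Integrable (fun u : ℝ => Real.exp (-u ^ 2 / 2)) := by
  have := integrable_exp_neg_mul_sq (b := 1 / 2) (by norm_num)
  refine this.congr (Filter.Eventually.of_forall fun x => ?_)
  simp only; congr 1; ring

lemma gauss_total : ∫ u : ℝ, Real.exp (-u ^ 2 / 2) = Real.sqrt (2 * Real.pi) := by
  have := integral_gaussian (1 / 2)
  rw [show Real.pi / (1 / 2) = 2 * Real.pi by ring] at this
  rw [← this]
  congr 1; ext x; congr 1; ring

lemma kappa_pos : 0 < Real.sqrt (2 * Real.pi) := by positivity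

lemma kappa_ge : 2 ≤ Real.sqrt (2 * Real.pi) := by
  apply Real.le_sqrt_of_sq_le
  nlinarith [Real.pi_gt_three]

lemma kappa_le : Real.sqrt (2 * Real.pi) ≤ 2.52 := by
  rw [Real.sqrt_le_left (by norm_num)]
  nlinarith [Real.pi_lt_d2]

lemma kappa_G (x : ℝ) :
    Real.sqrt (2 * Real.pi) * Gcdf x = ∫ u in Set.Iic x, Real.exp (-u ^ 2 / 2) := by
  rw [Gcdf, mul_inv_cancel_left₀ kappa_pos.ne']

lemma kappa_tail (x : ℝ) :
    Real.sqrt (2 * Real.pi) * (1 - Gcdf x) = ∫ u in Set.Ioi x, Real.exp (-u ^ 2 / 2) := by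
  rw [mul_sub, kappa_G, mul_one, ← gauss_total,
    ← intervalIntegral.integral_Iic_add_Ioi gauss_integrable.integrableOn
      gauss_integrable.integrableOn (b := x)]
  ring

lemma Gcdf_neg (x : ℝ) : Gcdf (-x) = 1 - Gcdf x := by
  apply mul_left_cancel₀ kappa_pos.ne'
  rw [kappa_G, kappa_tail]
  have := integral_comp_neg_Iic (-x) (fun u => Real.exp (-u ^ 2 / 2))
  simpa using this

lemma Gcdf_nonneg (x : ℝ) : 0 ≤ Gcdf x := by
  unfold Gcdf
  have : 0 ≤ ∫ u in Set.Iic x, Real.exp (-u ^ 2 / 2) :=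
    MeasureTheory.integral_nonneg fun u => (Real.exp_pos _).le
  positivity

lemma Gcdf_le_one (x : ℝ) : Gcdf x ≤ 1 := by
  have := Gcdf_nonneg (-x)
  rw [Gcdf_neg] at this
  linarith

lemma Gcdf_sub (a b : ℝ) :
    Gcdf b - Gcdf a = (Real.sqrt (2 * Real.pi))⁻¹ * ∫ u in a..b, Real.exp (-u ^ 2 / 2) := by
  rw [Gcdf, Gcdf, ← mul_sub, intervalIntegral.integral_Iic_sub_Iic gauss_integrable.integrableOn
      gauss_integrable.integrableOn]

lemma gauss_cont : Continuous (fun u : ℝ => Real.exp (-u ^ 2 / 2)) := by fun_prop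

lemma Gcdf_hasDeriv (x : ℝ) :
    HasDerivAt Gcdf ((Real.sqrt (2 * Real.pi))⁻¹ * Real.exp (-x ^ 2 / 2)) x := by
  have h : Gcdf = fun y => Gcdf 0 + (Real.sqrt (2 * Real.pi))⁻¹ *
      ∫ u in (0:ℝ)..y, Real.exp (-u ^ 2 / 2) := by
    ext y
    rw [← Gcdf_sub]; ring
  rw [h]
  refine HasDerivAt.const_add _ (HasDerivAt.const_mul _ ?_)
  exact intervalIntegral.integral_hasDerivAt_right (gauss_cont.intervalIntegrable _ _)
    gauss_cont.stronglyMeasurable.stronglyMeasurableAtFilter gauss_cont.continuousAt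

lemma Gcdf_cont : Continuous Gcdf :=
  continuous_iff_continuousAt.2 fun x => (Gcdf_hasDeriv x).continuousAt

lemma Gcdf_mono : Monotone Gcdf :=
  monotone_of_hasDerivAt_nonneg Gcdf_hasDeriv (fun x => by simp only [Pi.zero_apply]; positivity)

lemma kinv_le : (Real.sqrt (2 * Real.pi))⁻¹ ≤ 1 / 2 := by
  rw [inv_le_comm₀ kappa_pos (by norm_num)]
  linarith [kappa_ge]

lemma Gcdf_lip {a b : ℝ} (h : a ≤ b) : Gcdf b - Gcdf a ≤ (b - a) / 2 := by
  have := Convex.image_sub_le_mul_sub_of_deriv_le (D := Set.univ) convex_univ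
    (f := Gcdf) Gcdf_cont.continuousOn (fun x _ => (Gcdf_hasDeriv x).differentiableAt.differentiableWithinAt)
    (C := 1 / 2) (fun x _ => by
      rw [(Gcdf_hasDeriv x).deriv]
      have h1 : Real.exp (-x ^ 2 / 2) ≤ 1 := Real.exp_le_one_iff.2 (by nlinarith [sq_nonneg x])
      nlinarith [kinv_le, Real.exp_pos (-x ^ 2 / 2), inv_pos.2 kappa_pos]) a trivial b trivial h
  linarith

/-- Mills ratio bound. -/
lemma mills {x : ℝ} (hx : 0 ≤ x) :
    x * (Real.sqrt (2 * Real.pi) * (1 - Gcdf x)) ≤ Real.exp (-x ^ 2 / 2) := by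
  rw [kappa_tail]
  have hd : ∀ u ∈ Set.Ici x, HasDerivAt (fun u : ℝ => - Real.exp (-u ^ 2 / 2))
      (u * Real.exp (-u ^ 2 / 2)) u := by
    intro u _
    have h1 : HasDerivAt (fun u : ℝ => -u ^ 2 / 2) (-u) u := by
      exact ((hasDerivAt_pow 2 u).neg.div_const 2).congr_deriv (by norm_num; ring)
    exact h1.exp.neg.congr_deriv (by ring)
  have ht : Filter.Tendsto (fun u : ℝ => - Real.exp (-u ^ 2 / 2)) Filter.atTop (nhds 0) := by
    rw [← neg_zero]
    refine Filter.Tendsto.neg ?_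
    refine Real.tendsto_exp_atBot.comp ?_
    have : Filter.Tendsto (fun u : ℝ => u ^ 2 / 2) Filter.atTop Filter.atTop :=
      (Filter.tendsto_pow_atTop (by norm_num)).atTop_div_const (by norm_num)
    refine (Filter.tendsto_neg_atTop_atBot.comp this).congr fun u => ?_
    simp [neg_div]
  have hnn : ∀ u ∈ Set.Ioi x, 0 ≤ u * Real.exp (-u ^ 2 / 2) := fun u hu =>
    mul_nonneg (hx.trans (le_of_lt hu)) (Real.exp_pos _).le
  have hint := MeasureTheory.integrableOn_Ioi_deriv_of_nonneg' hd hnn ht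
  have hval := MeasureTheory.integral_Ioi_of_hasDerivAt_of_nonneg' hd hnn ht
  have : x * ∫ u in Set.Ioi x, Real.exp (-u ^ 2 / 2)
      ≤ ∫ u in Set.Ioi x, u * Real.exp (-u ^ 2 / 2) := by
    rw [← MeasureTheory.integral_const_mul]
    refine MeasureTheory.setIntegral_mono_on (gauss_integrable.integrableOn.const_mul x) hint
      measurableSet_Ioi fun u hu => ?_
    exact mul_le_mul_of_nonneg_right (le_of_lt hu) (Real.exp_pos _).le
  rw [hval] at this
  linarith

/-- The solution of Stein's equation. -/
noncomputable def stein (z w : ℝ) : ℝ :=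
  Real.sqrt (2 * Real.pi) * Real.exp (w ^ 2 / 2) * (Gcdf (min w z) * (1 - Gcdf (max w z)))

lemma stein_nonneg (z w : ℝ) : 0 ≤ stein z w := by
  unfold stein
  have := Gcdf_nonneg (min w z)
  have : 0 ≤ 1 - Gcdf (max w z) := by linarith [Gcdf_le_one (max w z)]
  positivity

lemma stein_le_mills (z w : ℝ) :
    stein z w ≤ Real.exp (w ^ 2 / 2) * (Real.sqrt (2 * Real.pi) * (1 - Gcdf |w|)) := by
  have h1 : Gcdf (min w z) ≤ Gcdf w := Gcdf_mono (min_le_left _ _)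
  have h2 : Gcdf w ≤ Gcdf (max w z) := Gcdf_mono (le_max_left _ _)
  have a0 := Gcdf_nonneg (min w z)
  have a1 := Gcdf_le_one w
  have a2 := Gcdf_le_one (max w z)
  have key : Gcdf (min w z) * (1 - Gcdf (max w z)) ≤ 1 - Gcdf |w| := by
    rcases le_total 0 w with h | h
    · rw [abs_of_nonneg h]; nlinarith
    · rw [abs_of_nonpos h, Gcdf_neg]; nlinarith [Gcdf_nonneg (max w z)]
  unfold stein
  have hp : 0 ≤ Real.sqrt (2 * Real.pi) * Real.exp (w ^ 2 / 2) := by positivity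
  calc _ ≤ Real.sqrt (2 * Real.pi) * Real.exp (w ^ 2 / 2) * (1 - Gcdf |w|) :=
        mul_le_mul_of_nonneg_left key hp
    _ = _ := by ring

lemma abs_mul_stein_le (z w : ℝ) : |w| * stein z w ≤ 1 := by
  have h1 := mul_le_mul_of_nonneg_left (stein_le_mills z w) (abs_nonneg w)
  have h2 := mul_le_mul_of_nonneg_left (mills (abs_nonneg w)) (Real.exp_pos (w ^ 2 / 2)).le
  rw [← Real.exp_add, sq_abs, show w ^ 2 / 2 + -w ^ 2 / 2 = 0 by ring, Real.exp_zero] at h2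
  linarith

lemma stein_le (z w : ℝ) : stein z w ≤ 3 := by
  rcases le_total (1 / 2) |w| with h | h
  · nlinarith [abs_mul_stein_le z w, stein_nonneg z w]
  · have h1 := stein_le_mills z w
    have h2 : Real.exp (w ^ 2 / 2) ≤ 8 / 7 := by
      have hw : w ^ 2 / 2 ≤ 1 / 8 := by
        have := sq_abs w
        nlinarith [abs_nonneg w]
      have h3 : 1 - w ^ 2 / 2 ≤ Real.exp (-(w ^ 2 / 2)) := by
        have := Real.add_one_le_exp (-(w ^ 2 / 2)); linarith
      have h4 : Real.exp (w ^ 2 / 2) * Real.exp (-(w ^ 2 / 2)) = 1 := by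
        rw [← Real.exp_add]; simp
      nlinarith [Real.exp_pos (w ^ 2 / 2)]
    have h5 : Real.sqrt (2 * Real.pi) * (1 - Gcdf |w|) ≤ 2.52 := by
      nlinarith [kappa_le, kappa_pos, Gcdf_nonneg |w|]
    have h6 : 0 ≤ Real.sqrt (2 * Real.pi) * (1 - Gcdf |w|) :=
      mul_nonneg kappa_pos.le (by linarith [Gcdf_le_one |w|])
    nlinarith [Real.exp_pos (w ^ 2 / 2)]

lemma stein_cont (z : ℝ) : Continuous (stein z) := by
  unfold stein
  have := Gcdf_cont
  fun_prop

/-- The right-hand side of Stein's equation. -/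
noncomputable def steinD (z w : ℝ) : ℝ := w * stein z w + ((if w ≤ z then 1 else 0) - Gcdf z)

lemma kexp (w : ℝ) : Real.sqrt (2 * Real.pi) * Real.exp (w ^ 2 / 2) *
    ((Real.sqrt (2 * Real.pi))⁻¹ * Real.exp (-w ^ 2 / 2)) = 1 := by
  have h4 : Real.exp (w ^ 2 / 2) * Real.exp (-w ^ 2 / 2) = 1 := by
    rw [← Real.exp_add, show w ^ 2 / 2 + -w ^ 2 / 2 = 0 by ring, Real.exp_zero]
  have := mul_inv_cancel₀ kappa_pos.ne'
  calc _ = (Real.sqrt (2 * Real.pi) * (Real.sqrt (2 * Real.pi))⁻¹) *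
      (Real.exp (w ^ 2 / 2) * Real.exp (-w ^ 2 / 2)) := by ring
    _ = 1 := by rw [this, h4, one_mul]

lemma stein_hasDeriv {z w : ℝ} (h : w ≠ z) : HasDerivAt (stein z) (steinD z w) w := by
  have h1 : HasDerivAt (fun u : ℝ => Real.sqrt (2 * Real.pi) * Real.exp (u ^ 2 / 2))
      (Real.sqrt (2 * Real.pi) * (Real.exp (w ^ 2 / 2) * w)) w := by
    have : HasDerivAt (fun u : ℝ => u ^ 2 / 2) w w := by
      exact ((hasDerivAt_pow 2 w).div_const 2).congr_deriv (by norm_num)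
    exact this.exp.const_mul _
  have hk := kexp w
  rcases lt_or_gt_of_ne h with h | h
  · have h2 := h1.mul ((Gcdf_hasDeriv w).mul_const (1 - Gcdf z))
    have h3 : HasDerivAt (stein z) _ w := h2.congr_of_eventuallyEq (by
      filter_upwards [Iio_mem_nhds h] with u hu
      have hu' : u ≤ z := le_of_lt hu
      simp [stein, min_eq_left hu', max_eq_right hu'])
    refine h3.congr_deriv (Eq.symm ?_)
    simp only [steinD, stein, if_pos h.le, min_eq_left h.le, max_eq_right h.le]
    linear_combination -(1 - Gcdf z) * hk
  · have h2 := h1.mul (((Gcdf_hasDeriv w).const_sub 1).const_mul (Gcdf z))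
    have h3 : HasDerivAt (stein z) _ w := h2.congr_of_eventuallyEq (by
      filter_upwards [Ioi_mem_nhds h] with u hu
      have hu' : z ≤ u := le_of_lt hu
      simp [stein, min_eq_right hu', max_eq_left hu'])
    refine h3.congr_deriv (Eq.symm ?_)
    simp only [steinD, stein, if_neg (not_le.2 h), min_eq_right h.le, max_eq_left h.le]
    linear_combination Gcdf z * hk

lemma steinD_abs_le (z w : ℝ) : |steinD z w| ≤ 2 := by
  have h1 : |w * stein z w| ≤ 1 := by
    rw [abs_mul, abs_of_nonneg (stein_nonneg z w)]; exact abs_mul_stein_le z w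
  have h2 : |(if w ≤ z then 1 else 0) - Gcdf z| ≤ 1 := by
    have := Gcdf_nonneg z
    have := Gcdf_le_one z
    split_ifs <;> rw [abs_le] <;> constructor <;> linarith
  exact (abs_add_le _ _).trans (by linarith)

lemma ind_intervalIntegrable (c a b : ℝ) :
    IntervalIntegrable (fun x : ℝ => if x ≤ c then (1:ℝ) else 0) MeasureTheory.volume a b := by
  have : Antitone (fun x : ℝ => if x ≤ c then (1:ℝ) else 0) := by
    intro x y hxy
    simp only
    split_ifs <;> linarith
  exact this.intervalIntegrable

lemma steinD_intervalIntegrable (z a b : ℝ) :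
    IntervalIntegrable (steinD z) MeasureTheory.volume a b := by
  unfold steinD
  refine IntervalIntegrable.add ?_ (IntervalIntegrable.sub (ind_intervalIntegrable z a b) ?_)
  · exact (continuous_id.mul (stein_cont z)).intervalIntegrable _ _
  · exact intervalIntegrable_const

lemma stein_ftc (z a b : ℝ) : ∫ w in a..b, steinD z w = stein z b - stein z a := by
  refine MeasureTheory.integral_eq_of_hasDerivAt_off_countable (stein z) (steinD z)
    (s := {z}) (Set.countable_singleton z) (stein_cont z).continuousOn ?_
    (steinD_intervalIntegrable z a b)
  intro x hx
  exact stein_hasDeriv (by simpa using hx.2)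

lemma stein_lip (z a b : ℝ) : |stein z b - stein z a| ≤ 2 * |b - a| := by
  rw [← stein_ftc]
  exact intervalIntegral.norm_integral_le_of_norm_le_const (f := steinD z) (C := 2)
    fun x _ => steinD_abs_le z x
/-- Length of `[m, m+1] ∩ (-∞, c]`. -/
noncomputable def KK (c : ℝ) (m : ℕ) : ℝ := ∫ x in (m:ℝ)..(m:ℝ) + 1, if x ≤ c then (1:ℝ) else 0

lemma KK_le_one (c : ℝ) (m : ℕ) : KK c m ≤ 1 := by
  have h := intervalIntegral.integral_mono_on (a := (m:ℝ)) (b := (m:ℝ) + 1) (by linarith)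
    (ind_intervalIntegrable c m (m + 1)) (intervalIntegrable_const (c := (1:ℝ)))
    (fun x _ => by split_ifs <;> norm_num)
  simpa [KK] using h

lemma KK_nonneg (c : ℝ) (m : ℕ) : 0 ≤ KK c m := by
  apply intervalIntegral.integral_nonneg (by linarith)
  intro x _
  split_ifs <;> norm_num

lemma KK_eq_one {c : ℝ} {m : ℕ} (h : (m:ℝ) + 1 ≤ c) : KK c m = 1 := by
  have : KK c m = ∫ x in (m:ℝ)..(m:ℝ) + 1, (1:ℝ) := by
    apply intervalIntegral.integral_congr
    intro x hx
    rw [Set.uIcc_of_le (by linarith)] at hx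
    simp only
    rw [if_pos (hx.2.trans h)]
  rw [this]; simp

lemma KK_eq_zero {c : ℝ} {m : ℕ} (h : c < m) : KK c m = 0 := by
  have : KK c m = ∫ x in (m:ℝ)..(m:ℝ) + 1, (0:ℝ) := by
    apply intervalIntegral.integral_congr
    intro x hx
    rw [Set.uIcc_of_le (by linarith)] at hx
    simp only
    rw [if_neg (not_le.2 (h.trans_le hx.1))]
  rw [this]; simp

lemma scaled_ftc (z μ σ : ℝ) (hσ : 0 < σ) (m : ℕ) :
    σ * (stein z (((m + 1 : ℕ) : ℝ) / σ - μ / σ) - stein z ((m:ℝ) / σ - μ / σ)) =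
    (∫ x in (m:ℝ)..(m:ℝ) + 1, (x / σ - μ / σ) * stein z (x / σ - μ / σ))
      + (KK (μ + z * σ) m - Gcdf z) := by
  have hsub := intervalIntegral.integral_comp_div_sub (a := (m:ℝ)) (b := (m:ℝ) + 1) (steinD z)
    hσ.ne' (μ / σ)
  rw [stein_ftc, smul_eq_mul] at hsub
  push_cast
  rw [← hsub]
  have hc : Continuous fun x : ℝ => (x / σ - μ / σ) * stein z (x / σ - μ / σ) := by
    have := stein_cont z
    fun_prop
  have e : ∀ x : ℝ, steinD z (x / σ - μ / σ) = (x / σ - μ / σ) * stein z (x / σ - μ / σ) +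
      ((if x ≤ μ + z * σ then 1 else 0) - Gcdf z) := by
    intro x
    have hiff : (x / σ - μ / σ ≤ z) ↔ x ≤ μ + z * σ := by
      rw [← sub_div, div_le_iff₀ hσ]; constructor <;> intro h <;> linarith
    simp only [steinD, hiff]
  simp only [e]
  rw [intervalIntegral.integral_add (hc.intervalIntegrable _ _)
    ((ind_intervalIntegrable _ _ _).sub intervalIntegrable_const),
    intervalIntegral.integral_sub (ind_intervalIntegrable _ _ _) intervalIntegrable_const]
  simp [KK]

lemma h_close (z a b d : ℝ) (hd : |a - b| ≤ d) :
    |a * stein z a - b * stein z b| ≤ (2 * |a| + 3) * d := by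
  have e : a * stein z a - b * stein z b = a * (stein z a - stein z b) + (a - b) * stein z b := by
    ring
  rw [e]
  refine (abs_add_le _ _).trans ?_
  rw [abs_mul, abs_mul, abs_of_nonneg (stein_nonneg z b)]
  have h1 := stein_lip z b a
  have h2 := stein_le z b
  have h3 := stein_nonneg z b
  have h4 : |stein z a - stein z b| ≤ 2 * d := by linarith
  have h5 := mul_le_mul_of_nonneg_left h4 (abs_nonneg a)
  have h6 := mul_le_mul hd h2 h3 ((abs_nonneg _).trans hd)
  linarith

lemma H_close (z μ σ : ℝ) (hσ : 0 < σ) {n m : ℕ} (h1 : m ≤ n + 1) (h2 : n ≤ m + 2) :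
    |((n:ℝ) / σ - μ / σ) * stein z ((n:ℝ) / σ - μ / σ) -
      ∫ x in (m:ℝ)..(m:ℝ) + 1, (x / σ - μ / σ) * stein z (x / σ - μ / σ)|
      ≤ (2 * |(n:ℝ) / σ - μ / σ| + 3) * (2 / σ) := by
  have hc : Continuous fun x : ℝ => (x / σ - μ / σ) * stein z (x / σ - μ / σ) := by
    have := stein_cont z
    fun_prop
  set A := ((n:ℝ) / σ - μ / σ) * stein z ((n:ℝ) / σ - μ / σ) with hA
  have e : A - ∫ x in (m:ℝ)..(m:ℝ) + 1, (x / σ - μ / σ) * stein z (x / σ - μ / σ)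
      = ∫ x in (m:ℝ)..(m:ℝ) + 1, (A - (x / σ - μ / σ) * stein z (x / σ - μ / σ)) := by
    rw [intervalIntegral.integral_sub intervalIntegrable_const (hc.intervalIntegrable _ _)]
    simp
  rw [e]
  have := intervalIntegral.norm_integral_le_of_norm_le_const (a := (m:ℝ)) (b := (m:ℝ) + 1)
    (f := fun x => A - (x / σ - μ / σ) * stein z (x / σ - μ / σ))
    (C := (2 * |(n:ℝ) / σ - μ / σ| + 3) * (2 / σ)) (by
      intro x hx
      rw [Set.uIoc_of_le (by linarith)] at hx
      refine h_close z _ _ _ ?_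
      have h1' : (m:ℝ) ≤ n + 1 := by exact_mod_cast h1
      have h2' : (n:ℝ) ≤ m + 2 := by exact_mod_cast h2
      rw [show (n:ℝ) / σ - μ / σ - (x / σ - μ / σ) = (n - x) / σ by ring, abs_div, abs_of_pos hσ]
      refine div_le_div_of_nonneg_right ?_ hσ.le
      rw [abs_le]
      constructor <;> linarith [hx.1, hx.2])
  simpa using this

/-- Main estimate for the zero-biased distribution. -/
lemma zero_bias_bound {Q R : Polynomial ℝ} {μ σ : ℝ} (hσ : 0 < σ)
    (q1 : Q.eval 1 = 1) (qc : ∀ m, 0 ≤ Q.coeff m)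
    (hR : (Polynomial.X - 1) * R = Polynomial.X * Polynomial.derivative Q - Polynomial.C μ * Q)
    (hv : R.eval 1 = σ ^ 2)
    (hRH : ∀ h H : ℕ → ℝ, (∀ n m, m ≤ n + 1 → n ≤ m + 2 → h n ≤ H m) →
      R.eval 1 * LL h Q ≤ LL H R) (z : ℝ) :
    |LL (KK (μ + z * σ)) R - σ ^ 2 * Gcdf z| ≤ σ ^ 2 * (10 / σ) := by
  have hLR : ∀ g : ℕ → ℝ, LL (fun n => g (n + 1) - g n) R = LL (fun n => ((n:ℝ) - μ) * g n) Q := by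
    intro g
    rw [← LL_X_sub_one_mul, hR, map_sub, LL_X_deriv, ← Polynomial.smul_eq_C_mul, map_smul,
      smul_eq_mul, ← LL_fmul, ← LL_fsub]
    congr 2; ext n; ring
  -- second moment
  have hvar : LL (fun n => ((n:ℝ) / σ - μ / σ) ^ 2) Q = 1 := by
    have h := hLR (fun n => (n:ℝ) - μ)
    have e : (fun n : ℕ => ((n + 1 : ℕ) : ℝ) - μ - ((n:ℝ) - μ)) = fun _ => 1 := by
      ext n; push_cast; ring
    rw [e, LL_one, hv] at h
    have e2 : (fun n : ℕ => ((n:ℝ) / σ - μ / σ) ^ 2)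
        = fun n : ℕ => (σ ^ 2)⁻¹ * (((n:ℝ) - μ) * ((n:ℝ) - μ)) := by
      ext n; field_simp
    rw [e2, LL_fmul, ← h, inv_mul_cancel₀ (by positivity)]
  set w : ℕ → ℝ := fun n => (n:ℝ) / σ - μ / σ with hw
  set h : ℕ → ℝ := fun n => w n * stein z (w n) with hh
  set H : ℕ → ℝ := fun m => ∫ x in (m:ℝ)..(m:ℝ) + 1, (x / σ - μ / σ) * stein z (x / σ - μ / σ)
    with hH
  set ω : ℕ → ℝ := fun n => (2 * |w n| + 3) * (2 / σ) with hω
  have hωL : LL ω Q ≤ 10 / σ := by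
    have h1 : LL ω Q ≤ LL (fun n => (2 / σ) * (w n ^ 2 + 4)) Q := by
      refine LL_mono (fun n => ?_) qc
      simp only [hω]
      rw [mul_comm]
      refine mul_le_mul_of_nonneg_left ?_ (by positivity)
      nlinarith [sq_nonneg (|w n| - 1), sq_abs (w n)]
    rw [LL_fmul, LL_fadd, hvar, LL_const, q1] at h1
    refine h1.trans (le_of_eq ?_)
    ring
  have hstein : LL (KK (μ + z * σ)) R - σ ^ 2 * Gcdf z = σ ^ 2 * LL h Q - LL H R := by
    have h1 := hLR (fun n => σ * stein z (w n))
    have e1 : (fun n : ℕ => σ * stein z (w (n + 1)) - σ * stein z (w n))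
        = fun n => H n + (KK (μ + z * σ) n - Gcdf z) := by
      ext n
      rw [← mul_sub]
      exact scaled_ftc z μ σ hσ n
    have e2 : (fun n : ℕ => ((n:ℝ) - μ) * (σ * stein z (w n))) = fun n => σ ^ 2 * h n := by
      ext n
      simp only [hh, hw]
      field_simp
    rw [e1, e2, LL_fadd, LL_fsub, LL_const, LL_fmul, hv] at h1
    linarith
  rw [hstein]
  have hcl : ∀ n m : ℕ, m ≤ n + 1 → n ≤ m + 2 → |h n - H m| ≤ ω n := fun n m a b =>
    H_close z μ σ hσ a b
  have u1 := hRH (fun n => h n - ω n) H (fun n m a b => by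
    have := (abs_le.1 (hcl n m a b)).2; linarith)
  have u2 := hRH (fun n => (-1) * h n - ω n) (fun m => (-1) * H m) (fun n m a b => by
    have := (abs_le.1 (hcl n m a b)).1; linarith)
  rw [LL_fsub, hv] at u1
  rw [LL_fsub, LL_fmul, LL_fmul, hv] at u2
  have u3 := mul_le_mul_of_nonneg_left hωL (sq_nonneg σ)
  rw [abs_le]
  constructor <;> linarith

theorem clt_left_half_plane (N : ℕ) (P : Polynomial ℝ)
    (hcoeff : ∀ m, 0 ≤ P.coeff m)
    (hdeg : P.degree = N)
    (hp0 : 0 < P.coeff 0)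
    (hroots : ∀ ζ : ℂ, Polynomial.aeval ζ P = 0 → ζ.re ≤ 0)
    (hvar : 0 < VarX P) :
    ∀ x : ℝ, |Fcdf P x - Gcdf x| ≤ 12 / Real.sqrt (VarX P) := by
  intro z
  obtain ⟨q1, qc, R, hR, -, hRH⟩ := good_of_roots P hroots
  set Q := Polynomial.C (P.eval 1)⁻¹ * P with hQ
  have hLQ : ∀ g : ℕ → ℝ, LL g Q =
      (∑ m ∈ Finset.range (P.natDegree + 1), P.coeff m * g m) / Psum P := by
    intro g
    rw [hQ, ← Polynomial.smul_eq_C_mul, map_smul, smul_eq_mul, LL_eq_sum, Psum]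
    ring
  have hμ : LL (fun n => (n:ℝ)) Q = EX P := by
    rw [hLQ, EX]; simp only [mul_comm]
  have hμ' : (Polynomial.derivative Q).eval 1 = EX P := by
    rw [← hμ]
    have := LL_X_deriv (fun _ => 1) Q
    rw [LL_one] at this
    simpa using this
  rw [hμ'] at hR
  have hv : R.eval 1 = VarX P := by
    have h1 := LL_X_sub_one_mul (fun n => (n:ℝ)) R
    rw [hR, map_sub, LL_X_deriv, ← Polynomial.smul_eq_C_mul, map_smul, hμ, smul_eq_mul] at h1
    have e : (fun n : ℕ => ((n + 1 : ℕ) : ℝ) - (n:ℝ)) = fun _ => 1 := by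
      ext n; push_cast; ring
    rw [e, LL_one, hLQ] at h1
    rw [← h1, VarX, sq]
    congr 2
    exact Finset.sum_congr rfl fun m _ => by ring
  set σ := Real.sqrt (VarX P) with hσd
  have hσ : 0 < σ := Real.sqrt_pos.2 hvar
  have hσ2 : σ ^ 2 = VarX P := Real.sq_sqrt hvar.le
  set μ := EX P with hμd
  have hv2 : R.eval 1 = σ ^ 2 := by rw [hv, hσ2]
  have key := zero_bias_bound hσ q1 qc hR hv2 hRH
  have hF : Fcdf P z = LL (fun n => if (n:ℝ) ≤ μ + z * σ then 1 else 0) Q := by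
    rw [hLQ, Fcdf]; simp [hμd, hσd]
  have hsp : 0 < σ ^ 2 := by positivity
  have upper : σ ^ 2 * Fcdf P z ≤ LL (KK (μ + (z + 2 / σ) * σ)) R := by
    rw [hF, ← hv2]
    refine hRH _ _ fun n m a b => ?_
    have a' : (m:ℝ) ≤ n + 1 := by exact_mod_cast a
    have e : μ + (z + 2 / σ) * σ = μ + z * σ + 2 := by field_simp; ring
    split_ifs with hc
    · rw [KK_eq_one]
      rw [e]; linarith
    · exact KK_nonneg _ _
  have lower : LL (KK (μ + (z - 2 / σ) * σ)) R ≤ σ ^ 2 * Fcdf P z := by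
    have := hRH (fun n => (-1) * if (n:ℝ) ≤ μ + z * σ then 1 else 0)
      (fun m => (-1) * KK (μ + (z - 2 / σ) * σ) m) (fun n m a b => by
        have b' : (n:ℝ) ≤ m + 2 := by exact_mod_cast b
        have e : μ + (z - 2 / σ) * σ = μ + z * σ - 2 := by field_simp; ring
        split_ifs with hc
        · linarith [KK_le_one (μ + (z - 2 / σ) * σ) m]
        · rw [KK_eq_zero]
          rw [e]; linarith [not_le.1 hc])
    rw [LL_fmul, LL_fmul, ← hF, hv2] at this
    linarith
  have k1 := (abs_le.1 (key (z + 2 / σ))).2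
  have k2 := (abs_le.1 (key (z - 2 / σ))).1
  have hp : 0 < 2 / σ := by positivity
  have l1 := Gcdf_lip (a := z) (b := z + 2 / σ) (by linarith)
  have l2 := Gcdf_lip (a := z - 2 / σ) (b := z) (by linarith)
  have m1 : Fcdf P z ≤ Gcdf (z + 2 / σ) + 10 / σ := by
    apply le_of_mul_le_mul_left _ hsp
    linarith
  have m2 : Gcdf (z - 2 / σ) - 10 / σ ≤ Fcdf P z := by
    apply le_of_mul_le_mul_left _ hsp
    linarith
  have e10 : 10 / σ = 5 * (2 / σ) := by ring
  have e12 : 12 / σ = 6 * (2 / σ) := by ring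
  rw [e12, abs_le]
  constructor <;> linarith
end

section
/- Let P(z) = Σ_{m=0}^N p_m z^m be a polynomial with nonnegative real coefficients and p_0 > 0 such that every root ζ of P satisfies |arg(ζ)| ∈ [2π/3, π] (i.e., ζ lies in the closed wedge around the negative real axis of half-angle π/3). Then the coefficient sequence (p_m)_{m ≥ 0} is log-concave: p_m² ≥ p_{m−1}·p_{m+1} for all m ≥ 1 (with p_m = 0 for m > N). -/
open Real

namespace LCAux

/-- Coefficients extended by zero to the integers. -/
noncomputable def cf (P : Polynomial ℝ) (n : ℤ) : ℝ := if n < 0 then 0 else P.coeff n.toNat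

lemma cf_X_mul (P : Polynomial ℝ) (n : ℤ) : cf (Polynomial.X * P) n = cf P (n - 1) := by
  unfold cf
  rcases lt_trichotomy n 0 with h | h | h
  · rw [if_pos h, if_pos (by omega)]
  · subst h; simp
  · rw [if_neg (by omega), if_neg (by omega)]
    obtain ⟨k, rfl⟩ : ∃ k : ℕ, n = k + 1 := ⟨(n - 1).toNat, by omega⟩
    have h1 : ((k : ℤ) + 1).toNat = k + 1 := by omega
    have h2 : ((k : ℤ) + 1 - 1).toNat = k := by omega
    rw [h1, h2, Polynomial.coeff_X_mul]

lemma cf_add (P Q : Polynomial ℝ) (n : ℤ) : cf (P + Q) n = cf P n + cf Q n := by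
  unfold cf; split_ifs <;> simp

lemma cf_C_mul (a : ℝ) (P : Polynomial ℝ) (n : ℤ) :
    cf (Polynomial.C a * P) n = a * cf P n := by
  unfold cf; split_ifs <;> simp

/-- Nonnegative and log-concave without internal zeros. -/
def LC (x : ℤ → ℝ) : Prop :=
  (∀ n, 0 ≤ x n) ∧ ∀ i j : ℤ, i ≤ j → x (i - 1) * x (j + 1) ≤ x i * x j

lemma LC.shift {x : ℤ → ℝ} (h : LC x) (k : ℕ) : ∀ i j : ℤ, i ≤ j + k + 1 → 
    i ≤ j + 1 → x (i - 1 - k) * x (j + 1 + k) ≤ x i * x j := by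
  induction k with
  | zero =>
    intro i j _ h2
    rcases eq_or_lt_of_le h2 with h3 | h3
    · subst h3
      simp [mul_comm]
    · simpa using h.2 i j (by omega)
  | succ k ih =>
    intro i j _ h2
    have := h.2 (i - 1 - k) (j + 1 + k) (by omega)
    refine le_trans ?_ (ih i j (by omega) h2)
    have e1 : i - 1 - ((k + 1 : ℕ) : ℤ) = i - 1 - k - 1 := by push_cast; ring
    have e2 : j + 1 + ((k + 1 : ℕ) : ℤ) = j + 1 + k + 1 := by push_cast; ring
    rw [e1, e2]
    exact this

lemma LC.gen {x : ℤ → ℝ} (h : LC x) (i l j k : ℤ) (hs : i + l = j + k) (h1 : i ≤ j)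
    (h2 : i ≤ k) : x i * x l ≤ x j * x k := by
  wlog hjk : j ≤ k generalizing j k
  · rw [mul_comm (x j)]
    exact this k j (by omega) h2 h1 (by omega)
  rcases eq_or_lt_of_le h1 with h3 | h3
  · subst h3
    have : l = k := by omega
    rw [this]
  · have := h.shift (j - 1 - i).toNat j k (by omega) (by omega)
    have e1 : j - 1 - ((j - 1 - i).toNat : ℤ) = i := by omega
    have e2 : k + 1 + ((j - 1 - i).toNat : ℤ) = l := by omega
    rwa [e1, e2] at this

lemma LC.lin {x y : ℤ → ℝ} (h : LC x) (a : ℝ) (ha : 0 ≤ a)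
    (hy : ∀ n, y n = a * x n + x (n - 1)) : LC y := by
  refine ⟨fun n => ?_, fun i j hij => ?_⟩
  · rw [hy]; have := h.1 n; have := h.1 (n - 1); positivity
  · simp only [hy]
    have e1 : i - 1 - 1 = i - 2 := by ring
    have e2 : j + 1 - 1 = j := by ring
    rw [e1, e2]
    have t1 := h.gen (i - 1) (j + 1) i j (by ring) (by omega) (by omega)
    have t2 := h.gen (i - 2) (j + 1) i (j - 1) (by ring) (by omega) (by omega)
    have t3 := h.gen (i - 2) j (i - 1) (j - 1) (by ring) (by omega) (by omega)
    have u1 := mul_le_mul_of_nonneg_left t1 (mul_nonneg ha ha)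
    have u2 := mul_le_mul_of_nonneg_left t2 ha
    linarith

lemma LC.quad {x y : ℤ → ℝ} (h : LC x) (b c : ℝ) (hb : 0 ≤ b) (hc : 0 ≤ c) (hbc : c ≤ b ^ 2)
    (hy : ∀ n, y n = c * x n + b * x (n - 1) + x (n - 2)) : LC y := by
  refine ⟨fun n => ?_, fun i j hij => ?_⟩
  · rw [hy]; have := h.1 n; have := h.1 (n - 1); have := h.1 (n - 2); positivity
  · simp only [hy]
    have e1 : i - 1 - 1 = i - 2 := by ring
    have e2 : j + 1 - 1 = j := by ring
    have e3 : i - 1 - 2 = i - 3 := by ring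
    have e4 : j + 1 - 2 = j - 1 := by ring
    rw [e1, e2, e3, e4]
    have t1 := h.gen (i - 1) (j + 1) i j (by ring) (by omega) (by omega)
    have t2 := h.gen (i - 2) (j + 1) i (j - 1) (by ring) (by omega) (by omega)
    have t3 := h.gen (i - 3) (j + 1) i (j - 2) (by ring) (by omega) (by omega)
    have t4 := h.gen (i - 2) j (i - 1) (j - 1) (by ring) (by omega) (by omega)
    have t5 := h.gen (i - 3) j (i - 1) (j - 2) (by ring) (by omega) (by omega)
    have t6 := h.gen (i - 3) (j - 1) (i - 2) (j - 2) (by ring) (by omega) (by omega)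
    have u1 := mul_le_mul_of_nonneg_left t1 (mul_nonneg hc hc)
    have u2 := mul_le_mul_of_nonneg_left t2 (mul_nonneg hb hc)
    have u3 := mul_le_mul_of_nonneg_left t3 hc
    have u4 := mul_nonneg (sub_nonneg.2 hbc) (sub_nonneg.2 t4)
    have u5 := mul_le_mul_of_nonneg_left t5 hb
    linarith

lemma arg_re (z : ℂ) (h : |Complex.arg z| ∈ Set.Icc (2 * π / 3) π) :
    z.re < 0 ∧ ‖z‖ ^ 2 ≤ (2 * z.re) ^ 2 := by
  have hz : z ≠ 0 := by
    rintro rfl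
    have := h.1
    simp at this
    linarith [Real.pi_pos]
  have hc : Real.cos (Complex.arg z) ≤ -(1/2) := by
    rw [← Real.cos_abs]
    have h3 : Real.cos (2 * π / 3) = -(1/2) := by
      rw [show 2 * π / 3 = π - π / 3 by ring, Real.cos_pi_sub, Real.cos_pi_div_three]
    rw [← h3]
    exact Real.cos_le_cos_of_nonneg_of_le_pi (by positivity) h.2 h.1
  have hn : 0 < ‖z‖ := norm_pos_iff.2 hz
  have := Complex.norm_mul_cos_arg z
  have h4 : z.re ≤ - (‖z‖ / 2) := by nlinarith
  exact ⟨by linarith, by nlinarith⟩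

open Polynomial in
lemma main (n : ℕ) : ∀ P : Polynomial ℝ, P.natDegree = n → 0 < P.leadingCoeff →
    (∀ ζ : ℂ, Polynomial.aeval ζ P = 0 → |Complex.arg ζ| ∈ Set.Icc (2 * π / 3) π) →
    LC (cf P) := by
  induction n using Nat.strong_induction_on with
  | _ n ih =>
  intro P hP hl hr
  rcases Nat.eq_zero_or_pos n with h0 | h0
  · obtain ⟨a, rfl⟩ := natDegree_eq_zero.1 (hP.trans h0)
    simp only [leadingCoeff_C] at hl
    have hz : ∀ m : ℤ, m ≠ 0 → cf (C a) m = 0 := by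
      intro m hm
      unfold cf
      split_ifs
      · rfl
      · rw [coeff_C, if_neg (by omega)]
    have hnn : ∀ m : ℤ, 0 ≤ cf (C a) m := by
      intro m
      by_cases hm : m = 0
      · subst hm; simp [cf, hl.le]
      · rw [hz m hm]
    refine ⟨hnn, fun i j hij => ?_⟩
    have : cf (C a) (i - 1) * cf (C a) (j + 1) = 0 := by
      by_cases h1 : i - 1 = 0
      · rw [hz (j + 1) (by omega), mul_zero]
      · rw [hz _ h1, zero_mul]
    rw [this]
    exact mul_nonneg (hnn _) (hnn _)
  · obtain ⟨z, hz⟩ : ∃ z : ℂ, aeval z P = 0 := by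
      apply IsAlgClosed.exists_aeval_eq_zero
      exact (natDegree_pos_iff_degree_pos.1 (hP ▸ h0)).ne'
    obtain ⟨hre, hnorm⟩ := arg_re z (hr z hz)
    by_cases him : z.im = 0
    · have hzr : z = (z.re : ℂ) := by apply Complex.ext <;> simp [him]
      have hroot : P.IsRoot z.re := by
        rw [hzr] at hz
        have : aeval (algebraMap ℝ ℂ z.re) P = 0 := hz
        rw [aeval_algebraMap_apply] at this
        simpa [IsRoot] using this
      obtain ⟨Q, hQ⟩ := dvd_iff_isRoot.2 hroot
      have hm : (X - C z.re).Monic := monic_X_sub_C _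
      have hlQ : 0 < Q.leadingCoeff := by
        rwa [hQ, leadingCoeff_mul, hm.leadingCoeff, one_mul] at hl
      have hd := hm.natDegree_mul' (leadingCoeff_ne_zero.1 hlQ.ne')
      rw [← hQ, natDegree_X_sub_C] at hd
      have hLQ := ih Q.natDegree (by omega) Q rfl hlQ
        (fun ζ hζ => hr ζ (by rw [hQ, map_mul, hζ, mul_zero]))
      refine hLQ.lin (-z.re) (by linarith) (fun n => ?_)
      rw [show P = X * Q + C (-z.re) * Q by rw [hQ, C_neg]; ring, cf_add, cf_X_mul, cf_C_mul]
      ring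
    · obtain ⟨Q, hQ⟩ := quadratic_dvd_of_aeval_eq_zero_im_ne_zero P hz him
      have hq : (X ^ 2 - C (2 * z.re) * X + C (‖z‖ ^ 2) : ℝ[X])
          = X ^ 2 + C (-(2 * z.re)) * X + C (‖z‖ ^ 2) := by rw [C_neg]; ring
      rw [hq] at hQ
      have hm : (X ^ 2 + C (-(2 * z.re)) * X + C (‖z‖ ^ 2) : ℝ[X]).Monic := by monicity!
      have hdq : (X ^ 2 + C (-(2 * z.re)) * X + C (‖z‖ ^ 2) : ℝ[X]).natDegree = 2 := by
        compute_degree!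
      have hlQ : 0 < Q.leadingCoeff := by
        rwa [hQ, leadingCoeff_mul, hm.leadingCoeff, one_mul] at hl
      have hd := hm.natDegree_mul' (leadingCoeff_ne_zero.1 hlQ.ne')
      rw [← hQ, hdq] at hd
      have hLQ := ih Q.natDegree (by omega) Q rfl hlQ
        (fun ζ hζ => hr ζ (by rw [hQ, map_mul, hζ, mul_zero]))
      refine hLQ.quad (-(2 * z.re)) (‖z‖ ^ 2) (by linarith) (by positivity) (by linarith)
        (fun n => ?_)
      rw [show P = X * (X * Q) + C (-(2 * z.re)) * (X * Q) + C (‖z‖ ^ 2) * Q by rw [hQ]; ring]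
      rw [cf_add, cf_add, cf_C_mul, cf_C_mul, cf_X_mul, cf_X_mul, cf_X_mul]
      rw [show n - 1 - 1 = n - 2 by ring]
      ring

end LCAux

/-- If `P` has nonnegative coefficients, `p₀ > 0`, and every complex root `ζ` of `P`
satisfies `|arg ζ| ∈ [2π/3, π]`, then the coefficient sequence of `P` is log-concave. -/
theorem coefficients_log_concave (P : Polynomial ℝ)
    (hcoeff : ∀ m, 0 ≤ P.coeff m)
    (hp0 : 0 < P.coeff 0)
    (hroots : ∀ ζ : ℂ, Polynomial.aeval ζ P = 0 →
      |Complex.arg ζ| ∈ Set.Icc (2 * π / 3) π) :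
    ∀ m : ℕ, 1 ≤ m → P.coeff (m - 1) * P.coeff (m + 1) ≤ P.coeff m ^ 2 := by
  have hne : P ≠ 0 := by rintro rfl; simp at hp0
  have hl : 0 < P.leadingCoeff :=
    lt_of_le_of_ne (hcoeff _) (Polynomial.leadingCoeff_ne_zero.2 hne).symm
  have h := LCAux.main _ P rfl hl hroots
  intro m hm
  obtain ⟨k, rfl⟩ : ∃ k, m = k + 1 := ⟨m - 1, by omega⟩
  have key : ∀ n : ℕ, LCAux.cf P n = P.coeff n := by
    intro n; simp [LCAux.cf]
  have := h.gen (k : ℕ) (k + 2 : ℕ) (k + 1 : ℕ) (k + 1 : ℕ) (by push_cast; ring) (by omega)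
    (by omega)
  rw [key, key, key] at this
  rw [sq]
  exact this
end

section
/- Let G be a finite graph (multiple edges allowed) with vertex set V and edge set E, every vertex of positive degree, and let C(v) be finite nonempty subsets of ℕ with at least one admissible subgraph. Suppose for each vertex v there is an angle φ_v ∈ [0, π/2] such that every nonzero complex root ζ of p_v satisfies |arg(ζ)| ∈ [π − φ_v, π]. Define S = { θ ∈ [−π, π] : there exists a family (θ_v)_{v ∈ V} with |θ_v| ≤ π/2 − φ_v for all v and θ_{v_1(e)} + θ_{v_2(e)} = θ for every edge e }. Then every nonzero complex root ξ of P_{(C)} satisfies |arg(ξ)| ∈ [max S, π]. -/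
open Finset Real

/-- The number of edges of the subgraph `M` incident to the vertex `v`
(the degree `d_M(v)`); for `M = univ` this is the degree `d_v` of `v` in `G`. -/
def degIn {V E : Type*} [Fintype E] [DecidableEq V]
    (v1 v2 : E → V) (M : Finset E) (v : V) : ℕ :=
  (M.filter (fun e => v1 e = v ∨ v2 e = v)).card

/-- The vertex polynomial `p_{C,d}(z) = Σ_{k ∈ C} C(d,k) z^k`, as a function of `z : ℂ`. -/
noncomputable def vPoly (C : Finset ℕ) (d : ℕ) (z : ℂ) : ℂ :=
  ∑ k ∈ C, (d.choose k : ℂ) * z ^ k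

/-- The graph-counting polynomial `P_{(C)}(z) = Σ_{M admissible} z^{|M|}`,
as a function of `z : ℂ`. -/
noncomputable def gcPoly {V E : Type*} [Fintype V] [Fintype E] [DecidableEq V] [DecidableEq E]
    (v1 v2 : E → V) (C : V → Finset ℕ) (z : ℂ) : ℂ :=
  ∑ M ∈ Finset.univ.filter (fun M : Finset E => ∀ v, degIn v1 v2 M v ∈ C v), z ^ M.card

/-- The set `S` of angles `θ ∈ [−π, π]` admitting a family `(θ_v)` with
`|θ_v| ≤ π/2 − φ_v` and `θ_{v₁(e)} + θ_{v₂(e)} = θ` for every edge `e`. -/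
def angleSet {V E : Type*} (v1 v2 : E → V) (φ : V → ℝ) : Set ℝ :=
  {θ : ℝ | θ ∈ Set.Icc (-π) π ∧
    ∃ θv : V → ℝ, (∀ v, |θv v| ≤ π / 2 - φ v) ∧ ∀ e, θv (v1 e) + θv (v2 e) = θ}


lemma asano_core (b c : ℂ) (r δ : ℝ) (hr : 0 < r) (hδ : 0 < δ) :
    ∃ u v : ℂ, -δ < u.re ∧ -δ < v.re ∧ u * v + b * u + c * v = r := by
  by_cases hc : 0 < c.re
  · refine ⟨0, r / c, by simpa using hδ, ?_, ?_⟩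
    · have : 0 < ((r:ℂ) / c).re := by
        rw [Complex.div_re]
        have hn : 0 < Complex.normSq c := by
          apply Complex.normSq_pos.2
          rintro rfl
          simp at hc
        simp only [Complex.ofReal_re, Complex.ofReal_im, zero_mul, zero_div, add_zero]
        positivity
      linarith
    · have : c ≠ 0 := by
        rintro rfl
        simp at hc
      field_simp
      ring
  · push Not at hc
    set m : ℂ := r + b * c
    obtain ⟨t, ht, h1, h2⟩ : ∃ t : ℝ, 0 < t ∧ t * |m.re| < δ ∧ t * |b.re| < 1 := by
      refine ⟨min (δ / (|m.re| + 1)) (1 / (|b.re| + 1)), by positivity, ?_, ?_⟩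
      · calc _ ≤ (δ / (|m.re| + 1)) * |m.re| := by gcongr; exact min_le_left _ _
          _ < δ := by
            rw [div_mul_eq_mul_div, div_lt_iff₀ (by positivity)]
            nlinarith
      · calc _ ≤ (1 / (|b.re| + 1)) * |b.re| := by gcongr; exact min_le_right _ _
          _ < 1 := by
            rw [div_mul_eq_mul_div, div_lt_iff₀ (by positivity)]
            nlinarith
    have htc : (t : ℂ) ≠ 0 := by exact_mod_cast ht.ne'
    refine ⟨-c + t * m, (t⁻¹ : ℝ) - b, ?_, ?_, ?_⟩
    · simp only [Complex.add_re, Complex.neg_re, Complex.re_ofReal_mul]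
      nlinarith [neg_abs_le m.re]
    · simp only [Complex.sub_re, Complex.ofReal_re]
      have : |b.re| < t⁻¹ := by
        rw [← one_div, lt_div_iff₀ ht]; linarith
      linarith [le_abs_self b.re]
    · push_cast
      field_simp
      simp only [m]
      ring

/-- Asano contraction -/
lemma asano (A B C D : ℂ) (α β ε r : ℝ) (hα : |α| < π / 2) (hβ : |β| < π / 2) (hε : 0 < ε)
    (hr : 0 < r)
    (h : ∀ z w : ℂ, 0 < (Complex.exp (-(α * Complex.I)) * z).re →
      0 < (Complex.exp (-(β * Complex.I)) * w).re → A + B * z + C * w + D * (z * w) ≠ 0) :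
    A + B * ε + C * ε + D * (ε ^ 2 + r * Complex.exp ((α + β) * Complex.I)) ≠ 0 := by
  intro h0
  have hexp : ∀ x : ℝ, (Complex.exp (-(x * Complex.I))).re = Real.cos x := by
    intro x
    have : -((x:ℂ) * Complex.I) = ((-x : ℝ) : ℂ) * Complex.I := by push_cast; ring
    rw [this, Complex.exp_ofReal_mul_I_re, Real.cos_neg]
  have hca : 0 < Real.cos α := Real.cos_pos_of_mem_Ioo ⟨by linarith [neg_abs_le α], by linarith [le_abs_self α]⟩
  have hcb : 0 < Real.cos β := Real.cos_pos_of_mem_Ioo ⟨by linarith [neg_abs_le β], by linarith [le_abs_self β]⟩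
  set p := Complex.exp (α * Complex.I) with hp
  set q := Complex.exp (β * Complex.I) with hq
  have hpq : Complex.exp ((α + β) * Complex.I) = p * q := by
    rw [hp, hq, ← Complex.exp_add]; ring_nf
  have hp0 : p ≠ 0 := Complex.exp_ne_zero _
  have hq0 : q ≠ 0 := Complex.exp_ne_zero _
  have hpi : Complex.exp (-(α * Complex.I)) = p⁻¹ := by rw [Complex.exp_neg]
  have hqi : Complex.exp (-(β * Complex.I)) = q⁻¹ := by rw [Complex.exp_neg]
  have hpr := hexp α
  have hqr := hexp β
  rw [hpi] at hpr h
  rw [hqi] at hqr h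
  rw [hpq] at h0
  have hεε : A + B * ε + C * ε + D * (ε * ε) ≠ 0 := by
    apply h
    · rw [mul_comm, Complex.re_ofReal_mul, hpr]; positivity
    · rw [mul_comm, Complex.re_ofReal_mul, hqr]; positivity
  have hD : D ≠ 0 := by
    rintro rfl
    apply hεε
    linear_combination h0
  set δ := ε * min (Real.cos α) (Real.cos β)
  have hδ : 0 < δ := by positivity
  have hδ1 : δ ≤ ε * Real.cos α := by simp only [δ]; gcongr; exact min_le_left _ _
  have hδ2 : δ ≤ ε * Real.cos β := by simp only [δ]; gcongr; exact min_le_right _ _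
  obtain ⟨u, v, hu, hv, huv⟩ := asano_core ((B + D * ε) / (D * q)) ((C + D * ε) / (D * p)) r δ hr hδ
  refine h (p * u + ε) (q * v + ε) ?_ ?_ ?_
  · have : p⁻¹ * (p * u + ε) = u + ε * p⁻¹ := by field_simp
    rw [this, Complex.add_re, Complex.re_ofReal_mul, hpr]; linarith
  · have : q⁻¹ * (q * v + ε) = v + ε * q⁻¹ := by field_simp
    rw [this, Complex.add_re, Complex.re_ofReal_mul, hqr]; linarith
  · field_simp at huv
    linear_combination h0 +  huv

lemma laguerre_disc (x : ℝ) (hx : 0 < x) (u : ℂ) (hu : u ≠ 0) : ‖2 * x * u⁻¹ - 1‖ ≤ 1 ↔ x ≤ u.re := by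
  have h1 : 2 * x * u⁻¹ - 1 = (2 * x - u) / u := by field_simp
  have hn : 0 < ‖u‖ := norm_pos_iff.2 hu
  rw [h1, norm_div, div_le_one hn, ← sq_le_sq₀ (norm_nonneg _) (norm_nonneg _), Complex.sq_norm, Complex.sq_norm,
    Complex.normSq_apply, Complex.normSq_apply]
  simp
  constructor <;> intro h <;> nlinarith

lemma disc_sum (y : ℂ) (s : Multiset ℂ) (h : ∀ u ∈ s, ‖y * u - 1‖ ≤ 1) :
    ‖y * s.sum - s.card‖ ≤ s.card := by
  induction s using Multiset.induction with
  | empty => simp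
  | cons a s ih =>
    have h1 := ih (fun u hu => h u (Multiset.mem_cons_of_mem hu))
    have h2 := h a (Multiset.mem_cons_self _ _)
    simp only [Multiset.sum_cons, Multiset.card_cons]
    push_cast
    calc _ = ‖(y * a - 1) + (y * s.sum - s.card)‖ := by congr 1; ring
      _ ≤ _ := by linarith [norm_add_le (y * a - 1) (y * s.sum - s.card)]

open Polynomial in
/-- Laguerre's theorem -/
lemma laguerre (c : ℂ) (hc : c ≠ 0) (p : ℂ[X]) (d : ℕ) (hd : 0 < d) (hp : p.natDegree ≤ d)
    (h : ∀ z : ℂ, 0 < (c * z).re → p.eval z ≠ 0) (z w : ℂ) (hz : 0 < (c * z).re)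
    (hw : 0 < (c * w).re) : d * p.eval z + (w - z) * p.derivative.eval z ≠ 0 := by
  intro h0
  have hpz := h z hz
  have hdc : (d : ℂ) ≠ 0 := by exact_mod_cast hd.ne'
  by_cases hzw : z = w
  · subst hzw
    simp [hpz, hdc] at h0
  have hzw' : z - w ≠ 0 := sub_ne_zero.2 hzw
  have hs : p.Splits := IsAlgClosed.splits p
  have key := hs.eval_derivative_div_eval_of_ne_zero hpz
  set x := (c * z).re with hx
  set s := (p.roots.map fun y => (c * (z - y))⁻¹) with hsdef
  have hsum : s.sum = c⁻¹ * (p.derivative.eval z / p.eval z) := by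
    rw [key, hsdef, ← Multiset.sum_map_mul_left]
    congr 1
    apply Multiset.map_congr rfl
    intro y _
    simp [mul_comm]
  have hsum' : s.sum = d * (c * (z - w))⁻¹ := by
    rw [hsum]
    field_simp
    linear_combination -h0
  have hdisc := disc_sum (2 * x) s (by
    intro u hu
    obtain ⟨y, hy, rfl⟩ := Multiset.mem_map.1 hu
    have hy0 : p.eval y = 0 := (Polynomial.mem_roots'.1 hy).2
    have hyz : z - y ≠ 0 := by
      rintro h
      rw [sub_eq_zero] at h
      exact hpz (h ▸ hy0)
    rw [laguerre_disc x hz _ (mul_ne_zero hc hyz)]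
    have : ¬ 0 < (c * y).re := fun hh => h y hh hy0
    rw [mul_sub, Complex.sub_re]
    linarith)
  have hcard : s.card ≤ d := by
    rw [hsdef, Multiset.card_map]
    exact (p.card_roots').trans hp
  have hfin : ‖2 * x * s.sum - d‖ ≤ d := by
    have e : 2 * x * s.sum - d = (2 * x * s.sum - s.card) - ((d - s.card : ℝ) : ℂ) := by push_cast; ring
    rw [e]
    refine (norm_sub_le _ _).trans ?_
    rw [Complex.norm_real, Real.norm_of_nonneg (sub_nonneg.2 (by exact_mod_cast hcard))]
    linarith
  have : ‖2 * x * (c * (z - w))⁻¹ - 1‖ ≤ 1 := by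
    have e : 2 * x * s.sum - d = d * (2 * x * (c * (z - w))⁻¹ - 1) := by rw [hsum']; ring
    rw [e, norm_mul, Complex.norm_natCast] at hfin
    have : (0:ℝ) < d := by exact_mod_cast hd
    nlinarith
  rw [laguerre_disc x hz _ (mul_ne_zero hc hzw'), mul_sub, Complex.sub_re] at this
  linarith

open Polynomial in
lemma hurwitz_bound (p : ℂ[X]) (n : ℕ) (hn : p.natDegree ≤ n) (ξ w : ℂ) (r : ℝ) (hr : 0 < r)
    (h : ∀ z ∈ Metric.ball ξ r, p.eval z ≠ 0) :
    ‖p.eval w‖ ≤ ‖p.eval ξ‖ * (1 + ‖w - ξ‖ / r) ^ n := by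
  have hs : p.Splits := IsAlgClosed.splits p
  have key : ∀ s : Multiset ℂ, (∀ y ∈ s, r ≤ ‖ξ - y‖) → 
      ‖(s.map fun y => w - y).prod‖ ≤ ‖(s.map fun y => ξ - y).prod‖ * (1 + ‖w - ξ‖ / r) ^ s.card := by
    intro s
    induction s using Multiset.induction with
    | empty => simp
    | cons a s ih =>
      intro hh
      have h1 := ih (fun u hu => hh u (Multiset.mem_cons_of_mem hu))
      have h2 := hh a (Multiset.mem_cons_self _ _)
      simp only [Multiset.map_cons, Multiset.prod_cons, Multiset.card_cons, norm_mul]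
      have h3 : ‖w - a‖ ≤ ‖ξ - a‖ * (1 + ‖w - ξ‖ / r) := by
        calc ‖w - a‖ = ‖(ξ - a) + (w - ξ)‖ := by congr 1; ring
          _ ≤ ‖ξ - a‖ + ‖w - ξ‖ := norm_add_le _ _
          _ = ‖ξ - a‖ + r * (‖w - ξ‖ / r) := by field_simp
          _ ≤ ‖ξ - a‖ + ‖ξ - a‖ * (‖w - ξ‖ / r) := by gcongr
          _ = _ := by ring
      calc _ ≤ (‖ξ - a‖ * (1 + ‖w - ξ‖ / r)) * (‖(s.map fun y => ξ - y).prod‖ * (1 + ‖w - ξ‖ / r) ^ s.card) := by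
            gcongr
        _ = _ := by ring
  have hb : (1:ℝ) ≤ 1 + ‖w - ξ‖ / r := by
    have : 0 ≤ ‖w - ξ‖ / r := by positivity
    linarith
  rw [hs.eval_eq_prod_roots, hs.eval_eq_prod_roots, norm_mul, norm_mul, mul_assoc]
  gcongr
  refine (key _ ?_).trans ?_
  · intro y hy
    by_contra! hlt
    refine h y ?_ (Polynomial.mem_roots'.1 hy).2
    rw [Metric.mem_ball, dist_comm, dist_eq_norm]
    exact hlt
  · gcongr
    exact p.card_roots'.trans hn

open Polynomial in
/-- One step of polarization: Laguerre in coefficient form. -/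
lemma polar_step (c : ℂ) (hc : c ≠ 0) (a : ℕ → ℂ) (n : ℕ)
    (h : ∀ z : ℂ, 0 < (c * z).re →
      ∑ j ∈ Finset.range (n + 1 + 1), ((n + 1).choose j : ℂ) * a j * z ^ j ≠ 0)
    (w : ℂ) (hw : 0 < (c * w).re) (z : ℂ) (hz : 0 < (c * z).re) :
    ∑ j ∈ Finset.range (n + 1), (n.choose j : ℂ) * (a j + w * a (j + 1)) * z ^ j ≠ 0 := by
  set p : ℂ[X] := ∑ j ∈ Finset.range (n + 1 + 1), Polynomial.C (((n + 1).choose j : ℂ) * a j) * X ^ j with hp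
  have hev : ∀ z, p.eval z = ∑ j ∈ Finset.range (n + 1 + 1), ((n + 1).choose j : ℂ) * a j * z ^ j := by
    intro z
    simp [hp, eval_finsetSum]
  have hdeg : p.natDegree ≤ n + 1 := by
    apply natDegree_sum_le_of_forall_le
    intro j hj
    refine (natDegree_C_mul_X_pow_le _ _).trans ?_
    have := Finset.mem_range.1 hj
    omega
  have hder : p.derivative.eval z = ∑ j ∈ Finset.range (n + 1 + 1), ((n + 1).choose j : ℂ) * a j * (j * z ^ (j - 1)) := by
    simp [hp, eval_finsetSum, derivative_X_pow]
  have key := laguerre c hc p (n + 1) (by omega) hdeg (fun z hz => by rw [hev]; exact h z hz) z w hz hw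
  intro h0
  apply key
  have e1 : ∑ j ∈ Finset.range (n + 1 + 1), ((n + 1).choose j : ℂ) * a j * (j * z ^ (j - 1))
      = (n + 1) * ∑ j ∈ Finset.range (n + 1), (n.choose j : ℂ) * a (j + 1) * z ^ j := by
    rw [Finset.sum_range_succ', Finset.mul_sum]
    simp only [Nat.cast_zero, zero_mul, mul_zero, add_zero, Nat.add_sub_cancel]
    apply Finset.sum_congr rfl
    intro j _
    have := Nat.add_one_mul_choose_eq n j
    have h2 : ((n:ℂ) + 1) * (n.choose j : ℂ) = ((n+1).choose (j+1) : ℂ) * (j + 1) := by exact_mod_cast this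
    push_cast
    linear_combination (-(a (j+1) * z ^ j)) * h2
  have e2 : (n + 1) * ∑ j ∈ Finset.range (n + 1 + 1), ((n + 1).choose j : ℂ) * a j * z ^ j
      - z * ∑ j ∈ Finset.range (n + 1 + 1), ((n + 1).choose j : ℂ) * a j * (j * z ^ (j - 1))
      = (n + 1) * ∑ j ∈ Finset.range (n + 1), (n.choose j : ℂ) * a j * z ^ j := by
    have : ∑ j ∈ Finset.range (n + 1), (n.choose j : ℂ) * a j * z ^ j =
        ∑ j ∈ Finset.range (n + 1 + 1), (n.choose j : ℂ) * a j * z ^ j := by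
      rw [Finset.sum_range_succ _ (n + 1)]
      simp
    rw [this, Finset.mul_sum, Finset.mul_sum, Finset.mul_sum, ← Finset.sum_sub_distrib]
    apply Finset.sum_congr rfl
    intro j hj
    have hj' : j ≤ n + 1 := by have := Finset.mem_range.1 hj; omega
    have h1 := Nat.choose_mul_succ_eq n j
    have h2 : (n.choose j : ℂ) * (n + 1) = ((n+1).choose j : ℂ) * ((n + 1 : ℂ) - j) := by
      have := congrArg (Nat.cast : ℕ → ℂ) h1
      rw [Nat.cast_mul, Nat.cast_mul, Nat.cast_sub hj'] at this
      push_cast at this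
      exact this
    have h3 : z * ((j:ℂ) * z ^ (j - 1)) = j * z ^ j := by
      cases j with
      | zero => simp
      | succ k => simp [pow_succ]; ring
    linear_combination (-(a j * z ^ j)) * h2 - ((n+1).choose j : ℂ) * a j * h3
  have e3 : ∑ j ∈ Finset.range (n + 1), (n.choose j : ℂ) * (a j + w * a (j + 1)) * z ^ j
      = (∑ j ∈ Finset.range (n + 1), (n.choose j : ℂ) * a j * z ^ j)
       + w * ∑ j ∈ Finset.range (n + 1), (n.choose j : ℂ) * a (j + 1) * z ^ j := by
    rw [Finset.mul_sum, ← Finset.sum_add_distrib]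
    apply Finset.sum_congr rfl
    intro j _
    ring
  rw [e3] at h0
  rw [hev, hder]
  push_cast
  linear_combination (n + 1 : ℂ) * h0 + e2 + w * e1

/-- Grace–Walsh–Szegő for half-planes. -/
lemma grace {ι : Type*} [DecidableEq ι] (c : ℂ) (hc : c ≠ 0) (s : Finset ι) :
    ∀ (a : ℕ → ℂ), (∀ z : ℂ, 0 < (c * z).re →
      ∑ j ∈ Finset.range (s.card + 1), (s.card.choose j : ℂ) * a j * z ^ j ≠ 0) →
    ∀ z : ι → ℂ, (∀ i ∈ s, 0 < (c * z i).re) →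
      ∑ A ∈ s.powerset, a A.card * ∏ i ∈ A, z i ≠ 0 := by
  induction s using Finset.induction_on with
  | empty =>
    intro a h z _
    have := h c⁻¹ (by simp [hc])
    simpa using this
  | insert i s hi ih =>
    intro a h z hz
    rw [Finset.card_insert_of_notMem hi] at h
    have h1 := ih (fun j => a j + z i * a (j + 1))
      (fun x hx => polar_step c hc a s.card h (z i) (hz i (Finset.mem_insert_self _ _)) x hx) z
      (fun k hk => hz k (Finset.mem_insert_of_mem hk))
    rw [Finset.sum_powerset_insert hi, ← Finset.sum_add_distrib]
    convert h1 using 1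
    apply Finset.sum_congr rfl
    intro A hA
    have hiA : i ∉ A := fun h => hi (Finset.mem_powerset.1 hA h)
    rw [Finset.card_insert_of_notMem hiA, Finset.prod_insert hiA]
    ring

/-- Partition function over sets of half-edges. -/
noncomputable def ZZ {R E : Type*} [CommRing R] [Fintype E] [DecidableEq E]
    (c : Finset (E × Bool) → R) (w : E → Bool → Bool → R) : R :=
  ∑ T : Finset (E × Bool), c T * ∏ e, w e (decide ((e, false) ∈ T)) (decide ((e, true) ∈ T))

/-- Contracted weight. -/
def kw {R : Type*} [CommRing R] (ε ξ : R) (s t : Bool) : R :=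
  if s then (if t then ε ^ 2 + ξ else ε) else (if t then ε else 1)

/-- Product weight. -/
def pw {R : Type*} [CommRing R] (x y : R) (s t : Bool) : R :=
  (if s then x else 1) * (if t then y else 1)

lemma ZZ_update {E : Type*} [Fintype E] [DecidableEq E]
    (c : Finset (E × Bool) → ℂ) (w : E → Bool → Bool → ℂ) (e : E) :
    ∃ A B C D : ℂ, ∀ u : Bool → Bool → ℂ, ZZ c (Function.update w e u) =
      u false false * A + u true false * B + u false true * C + u true true * D := by
  let R : Finset (E × Bool) → ℂ := fun T =>
    ∏ eb ∈ Finset.univ.erase e, w eb (decide ((eb, false) ∈ T)) (decide ((eb, true) ∈ T))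
  let ind : Bool → Bool → ℂ := fun s t =>
    ∑ T : Finset (E × Bool), if decide ((e, false) ∈ T) = s ∧ decide ((e, true) ∈ T) = t then c T * R T else 0
  refine ⟨ind false false, ind true false, ind false true, ind true true, ?_⟩
  intro u
  simp only [ind, ZZ, Finset.mul_sum, ← Finset.sum_add_distrib]
  apply Finset.sum_congr rfl
  intro T _
  rw [← Finset.mul_prod_erase _ _ (Finset.mem_univ e)]
  have hR : ∏ eb ∈ Finset.univ.erase e, Function.update w e u eb (decide ((eb, false) ∈ T)) (decide ((eb, true) ∈ T)) = R T := by
    apply Finset.prod_congr rfl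
    intro eb he'
    rw [Function.update_of_ne (Finset.ne_of_mem_erase he')]
  rw [hR, Function.update_self]
  generalize decide ((e, false) ∈ T) = s
  generalize decide ((e, true) ∈ T) = t
  cases s <;> cases t <;> simp <;> ring

lemma contract {E : Type*} [Fintype E] [DecidableEq E]
    (c : Finset (E × Bool) → ℂ) (a b : E → ℝ) (ha : ∀ e, |a e| < π / 2) (hb : ∀ e, |b e| < π / 2)
    (ε r : ℝ) (hε : 0 < ε) (hr : 0 < r) (ξ : ℂ)
    (hξ : ∀ e, ξ = r * Complex.exp ((a e + b e) * Complex.I))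
    (h : ∀ x y : E → ℂ, (∀ e, 0 < (Complex.exp (-(a e * Complex.I)) * x e).re) →
      (∀ e, 0 < (Complex.exp (-(b e * Complex.I)) * y e).re) →
      ZZ c (fun e => pw (x e) (y e)) ≠ 0) (F : Finset E) :
    ∀ x y : E → ℂ, (∀ e, 0 < (Complex.exp (-(a e * Complex.I)) * x e).re) →
      (∀ e, 0 < (Complex.exp (-(b e * Complex.I)) * y e).re) →
      ZZ c (fun e => if e ∈ F then kw (ε : ℂ) ξ else pw (x e) (y e)) ≠ 0 := by
  induction F using Finset.induction_on with
  | empty => simpa using h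
  | insert e F he ih =>
    intro x y hx hy
    set w : E → Bool → Bool → ℂ := fun e => if e ∈ F then kw (ε : ℂ) ξ else pw (x e) (y e) with hw
    obtain ⟨A, B, C, D, hABCD⟩ := ZZ_update c w e
    have e1 : (fun eb => if eb ∈ insert e F then kw (ε : ℂ) ξ else pw (x eb) (y eb)) =
        Function.update w e (kw (ε : ℂ) ξ) := by
      funext eb
      by_cases hee : eb = e
      · subst hee; simp
      · rw [Function.update_of_ne hee]; simp [hw, hee]
    have e2 : ∀ p q : ℂ, (fun eb => if eb ∈ F then kw (ε : ℂ) ξ else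
        pw (Function.update x e p eb) (Function.update y e q eb)) =
        Function.update w e (pw p q) := by
      intro p q
      funext eb
      by_cases hee : eb = e
      · subst hee; simp [he]
      · rw [Function.update_of_ne hee, Function.update_of_ne hee, Function.update_of_ne hee]
    rw [e1, hABCD]
    have := asano A B C D (a e) (b e) ε r (ha e) (hb e) hε hr (by
      intro p q hp hq
      have := ih (Function.update x e p) (Function.update y e q) (by
        intro eb
        by_cases hee : eb = e
        · subst hee; simpa using hp
        · rw [Function.update_of_ne hee]; exact hx eb) (by
        intro eb
        by_cases hee : eb = e
        · subst hee; simpa using hq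
        · rw [Function.update_of_ne hee]; exact hy eb)
      rw [e2, hABCD] at this
      intro h0
      apply this
      simp only [pw]
      simp
      linear_combination h0)
    rw [← hξ e] at this
    intro h0
    apply this
    simp only [kw] at h0
    simp at h0
    linear_combination h0

/-- Endpoint of a half-edge. -/
def endp {V E : Type*} (v1 v2 : E → V) (h : E × Bool) : V := if h.2 then v2 h.1 else v1 h.1

/-- Indicator of admissibility on half-edge sets. -/
noncomputable def cc {V E : Type*} [Fintype V] [DecidableEq V]
    (v1 v2 : E → V) (C : V → Finset ℕ) (T : Finset (E × Bool)) : ℂ :=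
  ∏ v, if (T.filter (fun h => endp v1 v2 h = v)).card ∈ C v then 1 else 0

lemma card_endp {V E : Type*} [Fintype E] [DecidableEq V]
    (v1 v2 : E → V) (hne : ∀ e, v1 e ≠ v2 e) (M : Finset E) (v : V) :
    ((M ×ˢ (Finset.univ : Finset Bool)).filter (fun h => endp v1 v2 h = v)).card
      = degIn v1 v2 M v := by
  unfold degIn
  apply Finset.card_bij (fun h _ => h.1)
  · rintro ⟨e, s⟩ hh
    rw [Finset.mem_filter, Finset.mem_product] at hh
    cases s <;> simp [endp] at hh <;> simp [hh]
  · rintro ⟨e, s⟩ hh ⟨eb, sb⟩ hh' heq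
    simp only at heq
    subst heq
    have := hne e
    rw [Finset.mem_filter, Finset.mem_product] at hh hh'
    cases s <;> cases sb <;> simp [endp] at hh hh' <;> simp
    · exact this (hh.2.trans hh'.2.symm)
    · exact this (hh'.2.trans hh.2.symm)
  · intro e he
    rw [Finset.mem_filter] at he
    rcases he.2 with h | h
    · exact ⟨(e, false), by rw [Finset.mem_filter, Finset.mem_product]; simp [endp, he.1, h], rfl⟩
    · exact ⟨(e, true), by rw [Finset.mem_filter, Finset.mem_product]; simp [endp, he.1, h], rfl⟩

lemma prod_pw {E : Type*} [Fintype E] [DecidableEq E] (x y : E → ℂ) (T : Finset (E × Bool)) :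
    ∏ e, pw (x e) (y e) (decide ((e, false) ∈ T)) (decide ((e, true) ∈ T)) =
      ∏ h ∈ T, if h.2 then y h.1 else x h.1 := by
  have : ∏ h ∈ T, (if h.2 then y h.1 else x h.1) =
      ∏ h : E × Bool, if h ∈ T then (if h.2 then y h.1 else x h.1) else 1 := by
    rw [Finset.prod_ite_mem, Finset.univ_inter]
  rw [this, Fintype.prod_prod_type]
  apply Finset.prod_congr rfl
  intro e _
  simp [pw, mul_comm]

lemma ZZ_prod {V E : Type*} [Fintype V] [Fintype E] [DecidableEq V] [DecidableEq E]
    (v1 v2 : E → V) (C : V → Finset ℕ) (x y : E → ℂ) :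
    ZZ (cc v1 v2 C) (fun e => pw (x e) (y e)) =
      ∏ v, ∑ A ∈ (Finset.univ.filter (fun h : E × Bool => endp v1 v2 h = v)).powerset,
        (if A.card ∈ C v then (1 : ℂ) else 0) * ∏ h ∈ A, if h.2 then y h.1 else x h.1 := by
  rw [Finset.prod_univ_sum]
  unfold ZZ
  refine Finset.sum_bij' (fun T _ => fun v => T.filter (fun h => endp v1 v2 h = v))
    (fun p _ => Finset.univ.filter (fun h => h ∈ p (endp v1 v2 h))) ?_ ?_ ?_ ?_ ?_
  · intro T _
    rw [Fintype.mem_piFinset]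
    intro v
    rw [Finset.mem_powerset]
    exact Finset.filter_subset_filter _ (Finset.subset_univ _)
  · intro p _
    exact Finset.mem_univ _
  · intro T _
    ext h
    simp
  · intro p hp
    rw [Fintype.mem_piFinset] at hp
    funext v
    ext h
    simp only [Finset.mem_filter, Finset.mem_univ, true_and]
    constructor
    · rintro ⟨h1, h2⟩
      rw [← h2]; exact h1
    · intro hh
      have := Finset.mem_powerset.1 (hp v) hh
      have h2 : endp v1 v2 h = v := by simpa using this
      exact ⟨by rw [h2]; exact hh, h2⟩
  · intro T _
    rw [prod_pw, Finset.prod_mul_distrib, Finset.prod_fiberwise]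
    rfl

lemma ZZ_zero {V E : Type*} [Fintype V] [Fintype E] [DecidableEq V] [DecidableEq E]
    (v1 v2 : E → V) (hne : ∀ e, v1 e ≠ v2 e) (C : V → Finset ℕ) (ξ : ℂ) :
    ZZ (cc v1 v2 C) (fun _ => kw 0 ξ) = gcPoly v1 v2 C ξ := by
  unfold gcPoly
  rw [Finset.sum_filter]
  symm
  unfold ZZ
  refine Finset.sum_of_injOn (fun M : Finset E => M ×ˢ (Finset.univ : Finset Bool)) ?_ ?_ ?_ ?_
  · intro M _ Mb _ h
    ext e
    have := congrArg (fun T : Finset (E × Bool) => (e, true) ∈ T) h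
    simpa using this
  · intro M _
    simp
  · intro T _ hT
    by_cases hall : ∀ e, (e, false) ∈ T ↔ (e, true) ∈ T
    · exfalso
      apply hT
      refine ⟨Finset.univ.filter (fun e => (e, true) ∈ T), by simp, ?_⟩
      ext ⟨e, s⟩
      cases s <;> simp [hall e]
    · push Not at hall
      obtain ⟨e, he⟩ := hall
      rw [Finset.prod_eq_zero (Finset.mem_univ e), mul_zero]
      rcases he with ⟨h1, h2⟩ | ⟨h1, h2⟩ <;> simp [kw, h1, h2]
  · intro M _
    have h1 : cc v1 v2 C (M ×ˢ (Finset.univ : Finset Bool)) =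
        if ∀ v, degIn v1 v2 M v ∈ C v then 1 else 0 := by
      unfold cc
      simp only [card_endp v1 v2 hne]
      rw [Finset.prod_ite_zero]
      simp
    have h2 : ∏ e, kw 0 ξ (decide ((e, false) ∈ M ×ˢ (Finset.univ : Finset Bool)))
        (decide ((e, true) ∈ M ×ˢ (Finset.univ : Finset Bool))) = ξ ^ M.card := by
      have : ∀ e, kw 0 ξ (decide ((e, false) ∈ M ×ˢ (Finset.univ : Finset Bool)))
        (decide ((e, true) ∈ M ×ˢ (Finset.univ : Finset Bool))) = if e ∈ M then ξ else 1 := by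
        intro e
        by_cases he : e ∈ M <;> simp [kw, he]
      simp only [this]
      rw [Finset.prod_ite_mem, Finset.univ_inter, Finset.prod_const]
    rw [h1, h2]
    split_ifs <;> simp

open Polynomial in
/-- The regularized polynomial. -/
noncomputable def QQ {E : Type*} [Fintype E] [DecidableEq E] (c : Finset (E × Bool) → ℂ)
    (ε : ℝ) : ℂ[X] :=
  ZZ (fun T => Polynomial.C (c T)) (fun _ => kw (Polynomial.C (ε : ℂ)) X)

open Polynomial in
lemma QQ_eval {E : Type*} [Fintype E] [DecidableEq E] (c : Finset (E × Bool) → ℂ)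
    (ε : ℝ) (ξ : ℂ) : (QQ c ε).eval ξ = ZZ c (fun _ => kw (ε : ℂ) ξ) := by
  unfold QQ ZZ
  rw [eval_finsetSum]
  apply Finset.sum_congr rfl
  intro T _
  rw [eval_mul, eval_C, eval_prod]
  congr 1
  apply Finset.prod_congr rfl
  intro e _
  simp only [kw]
  split_ifs <;> simp

open Polynomial in
lemma QQ_deg {E : Type*} [Fintype E] [DecidableEq E] (c : Finset (E × Bool) → ℂ)
    (ε : ℝ) : (QQ c ε).natDegree ≤ Fintype.card E := by
  unfold QQ ZZ
  apply natDegree_sum_le_of_forall_le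
  intro T _
  refine (natDegree_C_mul_le _ _).trans ((natDegree_prod_le _ _).trans ?_)
  refine (Finset.sum_le_sum (g := fun _ => 1) ?_).trans (by simp)
  intro e _
  simp only [kw]
  split_ifs
  · rw [← C_pow, add_comm, natDegree_X_add_C]
  · simp
  · simp
  · simp

lemma ZZ_cont {E : Type*} [Fintype E] [DecidableEq E] (c : Finset (E × Bool) → ℂ) (ξ : ℂ) :
    Continuous (fun ε : ℝ => ZZ c (fun _ => kw (ε : ℂ) ξ)) := by
  unfold ZZ
  refine continuous_finsetSum _ fun T _ => continuous_const.mul (continuous_finsetProd _ fun e _ => ?_)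
  simp only [kw]
  split_ifs <;> fun_prop

/-- Half-planes avoid the roots of the vertex polynomial. -/
lemma half_plane (α f : ℝ) (z : ℂ) (hα : |α| ≤ π / 2 - f) (hf0 : 0 ≤ f)
    (hz : 0 < (Complex.exp (-(α * Complex.I)) * z).re) : z ≠ 0 ∧ |Complex.arg z| < π - f := by
  have hz0 : z ≠ 0 := by
    rintro rfl
    simp at hz
  refine ⟨hz0, ?_⟩
  by_contra! hge
  have hE : Complex.exp (-(α * Complex.I)) * z = (‖z‖ : ℂ) * Complex.exp ((z.arg - α : ℝ) * Complex.I) := by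
    conv_lhs => rw [← Complex.norm_mul_exp_arg_mul_I z]
    rw [mul_left_comm, ← Complex.exp_add]
    congr 2
    push_cast
    ring
  rw [hE, Complex.re_ofReal_mul, Complex.exp_ofReal_mul_I_re] at hz
  have hcos : 0 < Real.cos (z.arg - α) := by
    by_contra! h
    nlinarith [norm_nonneg z]
  obtain ⟨h1, h2⟩ := abs_le.1 hα
  have h3 := Complex.arg_le_pi z
  have h4 := Complex.neg_pi_lt_arg z
  rcases le_abs.1 hge with h | h
  · have := Real.cos_nonpos_of_pi_div_two_le_of_le (x := z.arg - α) (by linarith) (by linarith)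
    linarith
  · have := Real.cos_nonpos_of_pi_div_two_le_of_le (x := -(z.arg - α)) (by linarith) (by linarith)
    rw [Real.cos_neg] at this
    linarith

lemma vPoly_eq (C : Finset ℕ) (d : ℕ) (z : ℂ) :
    ∑ j ∈ Finset.range (d + 1), (d.choose j : ℂ) * (if j ∈ C then 1 else 0) * z ^ j = vPoly C d z := by
  unfold vPoly
  have h1 : ∑ k ∈ C, (d.choose k : ℂ) * z ^ k = ∑ k ∈ C ∩ Finset.range (d + 1), (d.choose k : ℂ) * z ^ k := by
    symm
    apply Finset.sum_subset Finset.inter_subset_left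
    intro k hk hk'
    have : d < k := by
      by_contra! h
      exact hk' (Finset.mem_inter.2 ⟨hk, Finset.mem_range.2 (by omega)⟩)
    rw [Nat.choose_eq_zero_of_lt this]
    simp
  rw [h1, Finset.inter_comm, ← Finset.sum_ite_mem]
  apply Finset.sum_congr rfl
  intro j _
  split_ifs <;> simp

/-- If for each vertex `v` every nonzero root `ζ` of `p_v` satisfies
`|arg ζ| ∈ [π − φ_v, π]`, then every nonzero root `ξ` of the graph-counting polynomial
satisfies `|arg ξ| ∈ [max S, π]`. -/
theorem gcPoly_root_argument_bound {V E : Type*} [Fintype V] [Fintype E]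
    [DecidableEq V] [DecidableEq E]
    (v1 v2 : E → V) (hne : ∀ e, v1 e ≠ v2 e)
    (C : V → Finset ℕ) (hC : ∀ v, (C v).Nonempty)
    (hdeg : ∀ v, 0 < degIn v1 v2 Finset.univ v)
    (hadm : ∃ M : Finset E, ∀ v, degIn v1 v2 M v ∈ C v)
    (φ : V → ℝ) (hφ : ∀ v, φ v ∈ Set.Icc 0 (π / 2))
    (hroots : ∀ v, ∀ ζ : ℂ, ζ ≠ 0 → vPoly (C v) (degIn v1 v2 Finset.univ v) ζ = 0 →
      |Complex.arg ζ| ∈ Set.Icc (π - φ v) π) :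
    ∀ ξ : ℂ, ξ ≠ 0 → gcPoly v1 v2 C ξ = 0 →
      |Complex.arg ξ| ∈ Set.Icc (sSup (angleSet v1 v2 φ)) π := by
  intro ξ hξ hP
  refine ⟨?_, Complex.abs_arg_le_pi ξ⟩
  by_contra! hlt
  have hne0 : (angleSet v1 v2 φ).Nonempty :=
    ⟨0, ⟨by linarith [Real.pi_pos], Real.pi_pos.le⟩, fun _ => 0,
      fun v => by simpa using (hφ v).2, fun e => by simp⟩
  obtain ⟨θ, hθ, hlt⟩ := exists_lt_of_lt_csSup hne0 hlt
  obtain ⟨⟨_, hθπ⟩, θv, hθv, hθe⟩ := hθ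
  have hθ0 : 0 < θ := (abs_nonneg _).trans_lt hlt
  -- nonvanishing of the regularized polynomial in the open sector
  have hsec : ∀ z : ℂ, z ≠ 0 → |Complex.arg z| < θ → ∀ ε : ℝ, 0 < ε →
      ZZ (cc v1 v2 C) (fun _ => kw (ε : ℂ) z) ≠ 0 := by
    intro z hz hzarg ε hε
    set l := z.arg / θ with hl
    have hl1 : |l| ≤ 1 := by
      rw [hl, abs_div, abs_of_pos hθ0, div_le_one hθ0]
      exact hzarg.le
    have hl1' : |l| < 1 := by
      rw [hl, abs_div, abs_of_pos hθ0, div_lt_one hθ0]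
      exact hzarg
    have hα : ∀ v, |l * θv v| ≤ π / 2 - φ v := by
      intro v
      rw [abs_mul]
      nlinarith [hθv v, abs_nonneg (θv v)]
    have hα' : ∀ v, |l * θv v| < π / 2 := by
      intro v
      rw [abs_mul]
      have h1 := hθv v
      have h2 := (hφ v).1
      nlinarith [abs_nonneg (θv v), abs_nonneg l, Real.pi_pos]
    have hcon := contract (cc v1 v2 C) (fun e => l * θv (v1 e)) (fun e => l * θv (v2 e))
      (fun e => hα' _) (fun e => hα' _) ε ‖z‖ hε (norm_pos_iff.2 hz) z ?_ ?_ Finset.univ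
      (fun e => Complex.exp ((l * θv (v1 e) : ℝ) * Complex.I))
      (fun e => Complex.exp ((l * θv (v2 e) : ℝ) * Complex.I))
      (fun e => by rw [← Complex.exp_add]; simp)
      (fun e => by rw [← Complex.exp_add]; simp)
    · simpa using hcon
    · intro e
      have : (((l * θv (v1 e) : ℝ) : ℂ) + ((l * θv (v2 e) : ℝ) : ℂ)) = z.arg := by
        rw [← Complex.ofReal_add, ← mul_add, hθe e, hl, div_mul_cancel₀ _ hθ0.ne']
      rw [this]
      exact (Complex.norm_mul_exp_arg_mul_I z).symm
    · intro x y hx hy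
      rw [ZZ_prod]
      rw [Finset.prod_ne_zero_iff]
      intro v _
      have hcard : (Finset.univ.filter (fun h : E × Bool => endp v1 v2 h = v)).card
          = degIn v1 v2 Finset.univ v := by
        rw [← card_endp v1 v2 hne, Finset.univ_product_univ]
      refine grace (Complex.exp (-((l * θv v : ℝ) * Complex.I))) (Complex.exp_ne_zero _) _
        (fun j => if j ∈ C v then 1 else 0) ?_ (fun h : E × Bool => if h.2 then y h.1 else x h.1) ?_
      · intro u hu
        rw [hcard, vPoly_eq]
        intro h0
        obtain ⟨hu0, hua⟩ := half_plane _ _ u (hα v) (hφ v).1 hu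
        exact absurd (hroots v u hu0 h0).1 (not_le.2 hua)
      · rintro ⟨e, s⟩ he
        cases s
        · have : v1 e = v := by simpa [endp] using (Finset.mem_filter.1 he).2
          subst this
          simpa using hx e
        · have : v2 e = v := by simpa [endp] using (Finset.mem_filter.1 he).2
          subst this
          simpa using hy e
  have hslit : ξ ∈ Complex.slitPlane := by
    rw [Complex.mem_slitPlane_iff_arg]
    refine ⟨fun h => ?_, hξ⟩
    rw [h, abs_of_pos Real.pi_pos] at hlt
    linarith
  have hnb : ∀ᶠ z in nhds ξ, z ≠ 0 ∧ |Complex.arg z| < θ :=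
    (isOpen_ne.eventually_mem hξ).and
      (((Complex.continuousAt_arg hslit).abs).eventually_lt continuousAt_const hlt)
  obtain ⟨r, hr, hball⟩ := Metric.eventually_nhds_iff_ball.1 hnb
  set K := (1 + ‖(1:ℂ) - ξ‖ / r) ^ (Fintype.card E) with hK
  have hbound : ∀ ε : ℝ, 0 < ε → ‖ZZ (cc v1 v2 C) (fun _ => kw (ε : ℂ) 1)‖ ≤
      ‖ZZ (cc v1 v2 C) (fun _ => kw (ε : ℂ) ξ)‖ * K := by
    intro ε hε
    rw [← QQ_eval, ← QQ_eval]
    apply hurwitz_bound _ _ (QQ_deg _ _) _ _ _ hr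
    intro z hz
    rw [QQ_eval]
    exact hsec z (hball z hz).1 (hball z hz).2 ε hε
  have hlim : ‖ZZ (cc v1 v2 C) (fun _ => kw ((0:ℝ) : ℂ) 1)‖ ≤
      ‖ZZ (cc v1 v2 C) (fun _ => kw ((0:ℝ) : ℂ) ξ)‖ * K := by
    have t1 : Filter.Tendsto (fun ε : ℝ => ‖ZZ (cc v1 v2 C) (fun _ => kw (ε : ℂ) 1)‖)
        (nhdsWithin 0 (Set.Ioi 0)) (nhds ‖ZZ (cc v1 v2 C) (fun _ => kw ((0:ℝ) : ℂ) 1)‖) :=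
      ((ZZ_cont (cc v1 v2 C) 1).norm.tendsto 0).mono_left nhdsWithin_le_nhds
    have t2 : Filter.Tendsto (fun ε : ℝ => ‖ZZ (cc v1 v2 C) (fun _ => kw (ε : ℂ) ξ)‖ * K)
        (nhdsWithin 0 (Set.Ioi 0)) (nhds (‖ZZ (cc v1 v2 C) (fun _ => kw ((0:ℝ) : ℂ) ξ)‖ * K)) :=
      (((ZZ_cont (cc v1 v2 C) ξ).norm.mul continuous_const).tendsto 0).mono_left nhdsWithin_le_nhds
    refine le_of_tendsto_of_tendsto t1 t2 ?_
    filter_upwards [self_mem_nhdsWithin] with ε hε using hbound ε hε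
  rw [Complex.ofReal_zero, ZZ_zero v1 v2 hne, ZZ_zero v1 v2 hne, hP, norm_zero, zero_mul,
    norm_le_zero_iff] at hlim
  unfold gcPoly at hlim
  simp only [one_pow, Finset.sum_const, nsmul_eq_mul, mul_one, Nat.cast_eq_zero,
    Finset.card_eq_zero] at hlim
  obtain ⟨M, hM⟩ := hadm
  have : M ∈ Finset.univ.filter (fun M : Finset E => ∀ v, degIn v1 v2 M v ∈ C v) := by
    simpa using hM
  rw [hlim] at this
  simp at this
end
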